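/- arXiv:1910.02465 — 2 statements merged into one kernel-verified Lean document; each statement's English description precedes it below -/
import Mathlib

section
/- Let F be a field of characteristic p. (i) If p > 0, there is a constant C_p > 0 depending only on p such that for every n ≥ 1, every t ∈ {0,…,n}, every t-constant symmetric Boolean function f : {0,1}^n → {0,1}, and every ε ∈ (0,1/3), pdeg^F_ε(f) ≤ C_p·(√(t·log(1/ε)) + log(1/ε)). (ii) If p = 0, there is an absolute constant C > 0 such that for every n ≥ 2 and f, t, ε as above, pdeg^F_ε(f) ≤ C·log n·(√(t·log(1/ε)) + log(1/ε)). -/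
noncomputable section

open scoped BigOperators

/-- Embed a Boolean value into a field: `true ↦ 1`, `false ↦ 0`. -/
def bF (F : Type) [Field F] (b : Bool) : F := if b then 1 else 0

/-- A finitely supported probability distribution on polynomials in
`F[x_1,…,x_n]` (a probabilistic polynomial). -/
structure ProbPoly (F : Type) [Field F] (n : ℕ) where
  k : ℕ
  w : Fin k → ℝ
  w_nonneg : ∀ i, 0 ≤ w i
  w_sum : ∑ i, w i = 1
  poly : Fin k → MvPolynomial (Fin n) F

open Classical in
/-- The probability that the probabilistic polynomial `P` errs on input `a`
with respect to the Boolean function `f`. -/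
def errAt {F : Type} [Field F] {n : ℕ} (P : ProbPoly F n)
    (f : (Fin n → Bool) → Bool) (a : Fin n → Bool) : ℝ :=
  ∑ i, if MvPolynomial.eval (fun v => bF F (a v)) (P.poly i) = bF F (f a) then 0 else P.w i

/-- The ε-error probabilistic degree of a Boolean function over `F`: the least `d`
such that some probabilistic polynomial of degree at most `d` computes `f` with
error at most `ε` at each point. -/
def pdeg (F : Type) [Field F] {n : ℕ} (f : (Fin n → Bool) → Bool) (ε : ℝ) : ℕ :=
  sInf {d | ∃ P : ProbPoly F n, (∀ i, (P.poly i).totalDegree ≤ d) ∧ ∀ a, errAt P f a ≤ ε}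

/-- Hamming weight of a Boolean input. -/
def wt {n : ℕ} (a : Fin n → Bool) : ℕ := (Finset.univ.filter fun i => a i = true).card

/-- The period of a spectrum: the least `b ≥ 1` with `spec i = spec (i+b)`
whenever `i + b ≤ n`. -/
def period (n : ℕ) (spec : ℕ → Bool) : ℕ :=
  sInf {b | 1 ≤ b ∧ ∀ i, i + b ≤ n → spec i = spec (i + b)}

/-- `B(f)`: the least `k` such that the spectrum is constant on `[k, n-k]`. -/
def Bparam (n : ℕ) (spec : ℕ → Bool) : ℕ :=
  sInf {k | ∀ i j, k ≤ i → i + k ≤ n → k ≤ j → j + k ≤ n → spec i = spec j}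

/-! ### Basic polynomial tools -/

/-- The point of `F^n` attached to a Boolean input. -/
def ptOf (F : Type) [Field F] {n : ℕ} (a : Fin n → Bool) : Fin n → F := fun v => bF F (a v)

/-- Coordinatewise conjunction. -/
def maskB {n : ℕ} (r a : Fin n → Bool) : Fin n → Bool := fun i => r i && a i

lemma totalDegree_sum_le' {F : Type} [Field F] {n : ℕ} {ι : Type*} (s : Finset ι)
    (f : ι → MvPolynomial (Fin n) F) (d : ℕ) (h : ∀ i ∈ s, (f i).totalDegree ≤ d) :
    (∑ i ∈ s, f i).totalDegree ≤ d :=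
  MvPolynomial.totalDegree_finsetSum_le h

/-- Substituting `0` for masked variables. -/
def maskP {F : Type} [Field F] {n : ℕ} (r : Fin n → Bool) (P : MvPolynomial (Fin n) F) :
    MvPolynomial (Fin n) F :=
  MvPolynomial.aeval (fun i => if r i then MvPolynomial.X i else 0) P

lemma maskP_totalDegree {F : Type} [Field F] {n : ℕ} (r : Fin n → Bool)
    (P : MvPolynomial (Fin n) F) : (maskP r P).totalDegree ≤ P.totalDegree := by
  unfold maskP
  rw [MvPolynomial.aeval_def, MvPolynomial.eval₂_eq']
  apply totalDegree_sum_le'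
  intro s hs
  refine (MvPolynomial.totalDegree_mul _ _).trans ?_
  have h1 : ((algebraMap F (MvPolynomial (Fin n) F)) (MvPolynomial.coeff s P)).totalDegree = 0 := by
    rw [MvPolynomial.algebraMap_eq]; exact MvPolynomial.totalDegree_C _
  rw [h1, zero_add]
  refine (MvPolynomial.totalDegree_finsetProd _ _).trans ?_
  refine le_trans ?_ (MvPolynomial.le_totalDegree hs)
  rw [Finsupp.sum_fintype _ _ (by simp)]
  apply Finset.sum_le_sum
  intro i _
  refine (MvPolynomial.totalDegree_pow _ _).trans ?_
  have : (if r i = true then (MvPolynomial.X i : MvPolynomial (Fin n) F) else 0).totalDegree ≤ 1 := by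
    split_ifs
    · simp
    · simp
  nlinarith

lemma maskP_eval {F : Type} [Field F] {n : ℕ} (r a : Fin n → Bool)
    (P : MvPolynomial (Fin n) F) :
    MvPolynomial.eval (ptOf F a) (maskP r P) = MvPolynomial.eval (ptOf F (maskB r a)) P := by
  unfold maskP
  rw [MvPolynomial.aeval_def, MvPolynomial.eval₂_eq', map_sum, MvPolynomial.eval_eq' _ P]
  apply Finset.sum_congr rfl
  intro s _
  rw [map_mul, map_prod, MvPolynomial.algebraMap_eq, MvPolynomial.eval_C]
  congr 1
  apply Finset.prod_congr rfl
  intro i _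
  rw [map_pow]
  congr 1
  unfold ptOf maskB bF
  cases h : r i <;> simp

/-- elementary symmetric polynomials at Boolean points -/
lemma esymm_eval {F : Type} [Field F] {n : ℕ} (a : Fin n → Bool) (j : ℕ) :
    MvPolynomial.eval (ptOf F a) (MvPolynomial.esymm (Fin n) F j) = ((wt a).choose j : F) := by
  classical
  unfold MvPolynomial.esymm
  rw [map_sum]
  have h1 : ∀ t ∈ Finset.powersetCard j (Finset.univ : Finset (Fin n)),
      MvPolynomial.eval (ptOf F a) (∏ i ∈ t, (MvPolynomial.X i : MvPolynomial (Fin n) F))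
        = if t ⊆ Finset.univ.filter (fun i => a i = true) then 1 else 0 := by
    intro t _
    rw [map_prod]
    simp only [MvPolynomial.eval_X]
    split_ifs with h
    · apply Finset.prod_eq_one
      intro i hi
      have := h hi
      simp at this
      simp [ptOf, bF, this]
    · rw [Finset.not_subset] at h
      obtain ⟨i, hi, hi'⟩ := h
      apply Finset.prod_eq_zero hi
      simp at hi'
      simp [ptOf, bF, hi']
  rw [Finset.sum_congr rfl h1, ← Finset.sum_filter, Finset.sum_const, nsmul_eq_mul, mul_one]
  congr 1
  unfold wt
  rw [← Finset.card_powersetCard]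
  congr 1
  ext t
  simp only [Finset.mem_filter, Finset.mem_powersetCard, Finset.subset_univ, true_and]
  tauto

lemma esymm_totalDegree {F : Type} [Field F] {n : ℕ} (j : ℕ) :
    (MvPolynomial.esymm (Fin n) F j).totalDegree ≤ j := by
  unfold MvPolynomial.esymm
  apply totalDegree_sum_le'
  intro t ht
  refine (MvPolynomial.totalDegree_finsetProd _ _).trans ?_
  simp only [MvPolynomial.totalDegree_X, Finset.sum_const, smul_eq_mul, mul_one]
  exact (Finset.mem_powersetCard.mp ht).2.le

/-- Newton interpolation on an interval. -/
lemma newton_interp {F : Type} [Field F] (r : ℕ) : ∀ (α : ℕ) (φ : ℕ → F),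
    ∃ c : ℕ → F, ∀ w, α ≤ w → w ≤ α + r →
      ∑ j ∈ Finset.range (r + 1), c j * (w.choose j : F) = φ w := by
  induction r with
  | zero =>
    intro α φ
    refine ⟨fun _ => φ α, ?_⟩
    intro w h1 h2
    have : w = α := by omega
    subst this
    simp
  | succ r ih =>
    intro α φ
    obtain ⟨c, hc⟩ := ih α (fun w => φ (w + 1) - φ w)
    let Q : ℕ → F := fun w => ∑ j ∈ Finset.range (r + 1), c j * (w.choose (j + 1) : F)
    have hQ : ∀ w, Q (w + 1) - Q w = ∑ j ∈ Finset.range (r + 1), c j * (w.choose j : F) := by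
      intro w
      simp only [Q]
      rw [← Finset.sum_sub_distrib]
      apply Finset.sum_congr rfl
      intro j _
      rw [Nat.choose_succ_succ]
      push_cast
      ring
    refine ⟨fun j => if j = 0 then φ α - Q α else c (j - 1), ?_⟩
    have key : ∀ k, k ≤ r + 1 → Q (α + k) + (φ α - Q α) = φ (α + k) := by
      intro k
      induction k with
      | zero => intro _; simp
      | succ k ihk =>
        intro hk
        have h1 := ihk (by omega)
        have h2 := hQ (α + k)
        rw [hc (α + k) (by omega) (by omega)] at h2
        have h3 : Q (α + (k + 1)) = Q (α + k) + (φ (α + k + 1) - φ (α + k)) := by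
          rw [← h2]; simp [add_assoc]
        rw [h3]
        have : φ (α + (k + 1)) = φ (α + k + 1) := rfl
        rw [this]
        linear_combination h1
    intro w h1 h2
    rw [Finset.sum_range_succ']
    obtain ⟨k, rfl⟩ := Nat.exists_eq_add_of_le h1
    have := key k (by omega)
    simp only [Q] at this
    simpa [Q] using this

lemma interp_poly {F : Type} [Field F] (n r α : ℕ) (φ : ℕ → F) :
    ∃ P : MvPolynomial (Fin n) F, P.totalDegree ≤ r ∧
      ∀ a : Fin n → Bool, α ≤ wt a → wt a ≤ α + r →
        MvPolynomial.eval (ptOf F a) P = φ (wt a) := by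
  obtain ⟨c, hc⟩ := newton_interp r α φ
  refine ⟨∑ j ∈ Finset.range (r + 1), MvPolynomial.C (c j) * MvPolynomial.esymm (Fin n) F j, ?_, ?_⟩
  · apply totalDegree_sum_le'
    intro j hj
    refine (MvPolynomial.totalDegree_mul _ _).trans ?_
    rw [MvPolynomial.totalDegree_C, zero_add]
    refine (esymm_totalDegree j).trans ?_
    have := Finset.mem_range.mp hj
    omega
  · intro a h1 h2
    rw [map_sum, ← hc (wt a) h1 h2]
    apply Finset.sum_congr rfl
    intro j _
    rw [map_mul, MvPolynomial.eval_C, esymm_eval]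

/-! ### Families computing all weight indicators -/

/-- `ω` correctly computes at `a` all indicators of weights below `T`. -/
def GoodAt {F : Type} [Field F] {n : ℕ} (T : ℕ) (E : ℕ → MvPolynomial (Fin n) F)
    (a : Fin n → Bool) : Prop :=
  ∀ j < T, MvPolynomial.eval (ptOf F a) (E j) = if wt a = j then 1 else 0

open Classical in
/-- There is a random family of polynomials of degree at most `d` computing all the
indicators of weights below `T`, failing on an input `a` with probability `≤ η (wt a)`. -/
def Fam (F : Type) [Field F] (n T d : ℕ) (η : ℕ → ℝ) : Prop :=
  ∃ (Ω : Type) (_ : Fintype Ω) (_ : Nonempty Ω) (E : Ω → ℕ → MvPolynomial (Fin n) F),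
    (∀ ω j, (E ω j).totalDegree ≤ d) ∧
    ∀ a, ((Finset.univ.filter (fun ω => ¬ GoodAt T (E ω) a)).card : ℝ)
      ≤ η (wt a) * Fintype.card Ω

lemma wt_le {n : ℕ} (a : Fin n → Bool) : wt a ≤ n := by
  unfold wt
  exact (Finset.card_le_univ _).trans (by simp)

lemma wt_cons {n : ℕ} (b : Bool) (a : Fin n → Bool) :
    wt (Fin.cons b a : Fin (n + 1) → Bool) = (if b then 1 else 0) + wt a := by
  unfold wt
  simp only [Finset.card_filter]
  rw [Fin.sum_univ_succ]
  simp

lemma wt_maskB_le {n : ℕ} (r a : Fin n → Bool) : wt (maskB r a) ≤ wt a := by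
  unfold wt maskB
  apply Finset.card_le_card
  intro i
  simp

lemma maskB_cons {n : ℕ} (b c : Bool) (r a : Fin n → Bool) :
    maskB (Fin.cons b r : Fin (n + 1) → Bool) (Fin.cons c a : Fin (n + 1) → Bool)
      = (Fin.cons (b && c) (maskB r a) : Fin (n + 1) → Bool) := by
  funext i
  refine Fin.cases ?_ (fun i => ?_) i <;> simp [maskB]

/-- expectation of `φ` under a binomial distribution -/
def binE (w : ℕ) (φ : ℕ → ℝ) : ℝ :=
  (∑ i ∈ Finset.range (w + 1), (w.choose i : ℝ) * φ i) / 2 ^ w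

lemma binE_succ (w : ℕ) (φ : ℕ → ℝ) :
    2 * binE (w + 1) φ = binE w φ + binE w (fun i => φ (i + 1)) := by
  have h := Finset.sum_choose_succ_mul (fun i _ => φ i) w
  unfold binE
  rw [h, pow_succ]
  field_simp

lemma sum_cons {X : Type} [Fintype X] {n : ℕ} (G : (Fin (n + 1) → X) → ℝ) :
    ∑ r, G r = ∑ x : X, ∑ r : Fin n → X, G (Fin.cons x r : Fin (n + 1) → X) := by
  rw [← Fintype.sum_prod_type']
  exact (Fintype.sum_equiv (Fin.consEquiv (fun _ : Fin (n + 1) => X)) _ _ (fun x => rfl)).symm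

lemma mask_sum : ∀ {n : ℕ} (a : Fin n → Bool) (φ : ℕ → ℝ),
    ∑ r : Fin n → Bool, φ (wt (maskB r a)) = 2 ^ n * binE (wt a) φ := by
  intro n
  induction n with
  | zero =>
    intro a φ
    have h : ∀ b : Fin 0 → Bool, wt b = 0 := by intro b; simp [wt]
    simp [h, binE]
  | succ n ih =>
    intro a φ
    rw [sum_cons]
    obtain ⟨c, a', rfl⟩ : ∃ c a', a = (Fin.cons c a' : Fin (n + 1) → Bool) :=
      ⟨a 0, Fin.tail a, (Fin.cons_self_tail a).symm⟩
    simp only [maskB_cons, wt_cons, Fintype.sum_bool]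
    cases c
    · simp only [Bool.and_false, Bool.false_eq_true, if_false, zero_add]
      rw [ih a' φ]; ring
    · simp only [Bool.and_true, Bool.false_eq_true, if_false, zero_add, if_true]
      rw [ih a' φ, ih a' (fun i => φ (1 + i))]
      have := binE_succ (wt a') φ
      simp only [add_comm 1] 
      rw [pow_succ]
      linear_combination (-(2:ℝ)^n) * this

lemma binE_mono (w : ℕ) (φ ψ : ℕ → ℝ) (h : ∀ i ≤ w, φ i ≤ ψ i) : binE w φ ≤ binE w ψ := by
  unfold binE
  apply div_le_div_of_nonneg_right _ (by positivity)
  apply Finset.sum_le_sum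
  intro i hi
  apply mul_le_mul_of_nonneg_left _ (by positivity)
  exact h i (by have := Finset.mem_range.mp hi; omega)

lemma binE_add (w : ℕ) (φ ψ : ℕ → ℝ) : binE w (fun i => φ i + ψ i) = binE w φ + binE w ψ := by
  unfold binE
  rw [← add_div, ← Finset.sum_add_distrib]
  simp only [mul_add]

lemma binE_mul (w : ℕ) (c : ℝ) (φ : ℕ → ℝ) : binE w (fun i => c * φ i) = c * binE w φ := by
  unfold binE
  rw [← mul_div_assoc, Finset.mul_sum]
  congr 1
  apply Finset.sum_congr rfl
  intro i _
  ring

lemma binE_pow (w : ℕ) (x : ℝ) : binE w (fun i => x ^ i) = ((1 + x) / 2) ^ w := by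
  unfold binE
  rw [div_pow, add_comm 1 x, add_pow]
  congr 1
  apply Finset.sum_congr rfl
  intro i _
  simp; ring

lemma binE_const (w : ℕ) (c : ℝ) : binE w (fun _ => c) = c := by
  have h1 := binE_mul w c (fun i => 1 ^ i)
  rw [binE_pow] at h1
  simpa using h1

/-- The sampling step. -/
lemma fam_step {F : Type} [Field F] {n T' d : ℕ} {η' : ℕ → ℝ} (hF : Fam F n T' d η')
    (T r : ℕ) (α : ℕ → ℕ) (ok : ℕ → ℕ → Prop) (η : ℕ → ℝ)
    (hok : ∀ w i, ok w i → i ≤ w → (i < T' → α i ≤ w ∧ w ≤ α i + r) ∧ (T' ≤ i → T ≤ w))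
    (φ : ℕ → ℕ → ℝ)
    (hφ1 : ∀ w i, i ≤ w → ok w i → η' i ≤ φ w i)
    (hφ2 : ∀ w i, i ≤ w → ¬ ok w i → 1 ≤ φ w i)
    (hη : ∀ w ≤ n, binE w (φ w) ≤ η w) : Fam F n T (d + r) η := by
  classical
  obtain ⟨Ω, _, _, E, hd, hE⟩ := hF
  choose A hA1 hA2 using fun (u j : ℕ) =>
    interp_poly (F := F) n r (α u) (fun w => if w = j then 1 else 0)
  let E' : (Fin n → Bool) × Ω → ℕ → MvPolynomial (Fin n) F :=
    fun x j => ∑ u ∈ Finset.range T', maskP x.1 (E x.2 u) * A u j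
  refine ⟨(Fin n → Bool) × Ω, inferInstance, inferInstance, E', ?_, ?_⟩
  · intro x j
    apply totalDegree_sum_le'
    intro u _
    refine (MvPolynomial.totalDegree_mul _ _).trans ?_
    exact add_le_add ((maskP_totalDegree _ _).trans (hd _ _)) (hA1 _ _)
  · intro a
    have good : ∀ m ω, ok (wt a) (wt (maskB m a)) → GoodAt T' (E ω) (maskB m a) →
        GoodAt T (E' (m, ω)) a := by
      intro m ω h1 h2 j hj
      have hle := wt_maskB_le m a
      have h3 := hok _ _ h1 hle
      simp only [E']
      rw [map_sum]
      have h4 : ∀ u ∈ Finset.range T',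
          MvPolynomial.eval (ptOf F a) (maskP m (E ω u) * A u j)
            = if wt (maskB m a) = u then MvPolynomial.eval (ptOf F a) (A u j) else 0 := by
        intro u hu
        rw [map_mul, maskP_eval, h2 u (Finset.mem_range.mp hu)]
        split_ifs <;> simp
      rw [Finset.sum_congr rfl h4, Finset.sum_ite_eq]
      split_ifs with h5 h6 h6
      · have := h3.1 (Finset.mem_range.mp h5)
        rw [hA2 _ _ _ this.1 this.2, if_pos h6]
      · have := h3.1 (Finset.mem_range.mp h5)
        rw [hA2 _ _ _ this.1 this.2, if_neg h6]
      · have := h3.2 (by simpa using h5)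
        omega
      · rfl
    have hcard : ((Finset.univ.filter (fun x => ¬ GoodAt T (E' x) a)).card : ℝ)
        ≤ ∑ m : Fin n → Bool, φ (wt a) (wt (maskB m a)) * Fintype.card Ω := by
      rw [Finset.card_filter, Fintype.sum_prod_type]
      push_cast
      apply Finset.sum_le_sum
      intro m _
      have hle := wt_maskB_le m a
      by_cases h1 : ok (wt a) (wt (maskB m a))
      · refine le_trans ?_ (mul_le_mul_of_nonneg_right (hφ1 _ _ hle h1) (by positivity))
        refine le_trans ?_ (hE (maskB m a))
        rw [Finset.card_filter]
        push_cast
        apply Finset.sum_le_sum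
        intro ω _
        by_cases h2 : GoodAt T' (E ω) (maskB m a)
        · rw [if_neg (not_not.mpr (good m ω h1 h2)), if_neg (not_not.mpr h2)]
        · rw [if_pos h2]; split_ifs <;> norm_num
      · have h2 := hφ2 _ _ hle h1
        calc _ ≤ ∑ ω : Ω, (1 : ℝ) := by
              apply Finset.sum_le_sum; intro ω _; split_ifs <;> norm_num
          _ = 1 * Fintype.card Ω := by simp
          _ ≤ _ := mul_le_mul_of_nonneg_right h2 (by positivity)
    refine hcard.trans ?_
    rw [← Finset.sum_mul, mask_sum, Fintype.card_prod]
    have := hη (wt a) (wt_le a)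
    have h2 : Fintype.card (Fin n → Bool) = 2 ^ n := by simp
    rw [h2]
    push_cast
    have h3 : (0:ℝ) ≤ 2 ^ n * Fintype.card Ω := by positivity
    nlinarith

lemma fam_mono {F : Type} [Field F] {n T d : ℕ} {η : ℕ → ℝ} (h : Fam F n T d η)
    {T' d' : ℕ} {η' : ℕ → ℝ} (hT : T' ≤ T) (hd : d ≤ d') (hη : ∀ w ≤ n, η w ≤ η' w) :
    Fam F n T' d' η' := by
  classical
  obtain ⟨Ω, _, _, E, hd1, hE⟩ := h
  refine ⟨Ω, inferInstance, inferInstance, E, fun ω j => (hd1 ω j).trans hd, ?_⟩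
  intro a
  refine le_trans ?_ ((hE a).trans
    (mul_le_mul_of_nonneg_right (hη _ (wt_le a)) (by positivity)))
  norm_cast
  apply Finset.card_le_card
  intro ω
  simp only [Finset.mem_filter, Finset.mem_univ, true_and]
  intro h1 h2
  exact h1 (fun j hj => h2 j (by omega))

/-! ### The low-weight family over an arbitrary field -/

lemma choose_ratio (w T : ℕ) (hw : 8 * T ≤ w) (i : ℕ) : ∀ k, i + k ≤ 2 * T →
    3 ^ k * w.choose i ≤ w.choose (i + k) := by
  intro k
  induction k with
  | zero => intro _; simp
  | succ k ih =>
    intro h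
    have h1 := ih (by omega)
    have h2 := Nat.choose_succ_right_eq w (i + k)
    have h3 : 3 * (i + k + 1) ≤ w - (i + k) := by omega
    have h4 : w.choose (i + k) * (3 * (i + k + 1)) ≤ w.choose (i + k + 1) * (i + k + 1) := by
      rw [h2]; exact Nat.mul_le_mul_left _ h3
    have h5 : 3 * w.choose (i + k) ≤ w.choose (i + k + 1) := by
      apply Nat.le_of_mul_le_mul_right (c := i + k + 1) _ (by omega)
      linarith
    calc 3 ^ (k + 1) * w.choose i = 3 * (3 ^ k * w.choose i) := by ring
      _ ≤ 3 * w.choose (i + k) := by omega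
      _ ≤ _ := h5

lemma crossing (w T : ℕ) (hw : 8 * T < w) :
    binE w (fun i => if i < T then 1 else if i ≤ 8 * T then 0 else (1/3 : ℝ) ^ T)
      ≤ (1/3 : ℝ) ^ T := by
  set q : ℝ := (1/3 : ℝ) ^ T with hq
  have hq0 : 0 < q := by positivity
  have h1 : binE w (fun i => if i < T then 1 else if i ≤ 8 * T then 0 else q)
      ≤ binE w (fun i => q + ((if i ∈ Finset.range T then 1 else 0) +
        (-q) * (if i ∈ Finset.Ico T (2 * T) then 1 else 0))) := by
    apply binE_mono
    intro i _
    simp only [Finset.mem_range, Finset.mem_Ico]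
    split_ifs <;> first | omega | linarith
  refine h1.trans ?_
  rw [binE_add, binE_const, binE_add, binE_mul]
  have e1 : binE w (fun i => if i ∈ Finset.range T then 1 else 0)
      = (∑ i ∈ Finset.range T, (w.choose i : ℝ)) / 2 ^ w := by
    unfold binE
    congr 1
    simp only [mul_ite, mul_one, mul_zero]
    rw [← Finset.sum_filter]
    congr 1
    ext i; simp; omega
  have e2 : binE w (fun i => if i ∈ Finset.Ico T (2 * T) then 1 else 0)
      = (∑ i ∈ Finset.range T, (w.choose (i + T) : ℝ)) / 2 ^ w := by
    unfold binE
    congr 1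
    simp only [mul_ite, mul_one, mul_zero]
    rw [← Finset.sum_filter]
    have : Finset.filter (fun i => i ∈ Finset.Ico T (2 * T)) (Finset.range (w + 1))
        = Finset.Ico T (2 * T) := by
      ext i; simp; omega
    rw [this, Finset.sum_Ico_eq_sum_range]
    have h2 : 2 * T - T = T := by omega
    rw [h2]
    simp only [add_comm]
  rw [e1, e2]
  have h3 : (∑ i ∈ Finset.range T, (w.choose i : ℝ))
      ≤ q * ∑ i ∈ Finset.range T, (w.choose (i + T) : ℝ) := by
    rw [Finset.mul_sum]
    apply Finset.sum_le_sum
    intro i hi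
    have h4 := choose_ratio w T hw.le i T (by have := Finset.mem_range.mp hi; omega)
    have h5 : (3:ℝ) ^ T * w.choose i ≤ w.choose (i + T) := by exact_mod_cast h4
    have h6 : q * 3 ^ T = 1 := by
      rw [hq, ← mul_pow]; norm_num
    calc (w.choose i : ℝ) = q * (3 ^ T * w.choose i) := by rw [← mul_assoc, h6, one_mul]
      _ ≤ _ := mul_le_mul_of_nonneg_left h5 hq0.le
  have h7 : (0:ℝ) < 2 ^ w := by positivity
  have h8 : (∑ i ∈ Finset.range T, (w.choose i : ℝ)) / 2 ^ w
      ≤ q * ((∑ i ∈ Finset.range T, (w.choose (i + T) : ℝ)) / 2 ^ w) := by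
    rw [← mul_div_assoc]
    exact div_le_div_of_nonneg_right h3 h7.le
  linarith

lemma fam_low_aux (F : Type) [Field F] (n T : ℕ) : ∀ k : ℕ,
    Fam F n T (8 * T * (k + 1)) (fun w => (if w ≤ 8 * T then 0 else (1/3 : ℝ) ^ T)
      + (1/2 : ℝ) ^ (8 * T) * (1 + (1/2 : ℝ) ^ k) ^ w) := by
  classical
  intro k
  induction k with
  | zero =>
    choose A hA1 hA2 using fun (j : ℕ) =>
      interp_poly (F := F) n (8 * T) 0 (fun w => if w = j then 1 else 0)
    refine ⟨Unit, inferInstance, inferInstance, fun _ j => A j, ?_, ?_⟩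
    · intro _ j; simpa using hA1 j
    · intro a
      simp only [Fintype.card_unit, Nat.cast_one, mul_one]
      by_cases h : wt a ≤ 8 * T
      · have : Finset.univ.filter (fun _ : Unit => ¬ GoodAt T (fun j => A j) a) = ∅ := by
          apply Finset.filter_eq_empty_iff.mpr
          intro _ _
          rw [not_not]
          intro j _
          exact hA2 j a (by omega) (by omega)
        rw [this]
        simp only [Finset.card_empty, Nat.cast_zero]
        rw [if_pos h]
        positivity
      · have h1 : ((Finset.univ.filter (fun _ : Unit => ¬ GoodAt T (fun j => A j) a)).card : ℝ)
            ≤ 1 := by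
          have := Finset.card_filter_le (Finset.univ : Finset Unit)
            (fun _ : Unit => ¬ GoodAt T (fun j => A j) a)
          simp only [Finset.card_univ, Fintype.card_unit] at this
          exact_mod_cast this
        refine h1.trans ?_
        rw [if_neg h]
        have h2 : (1:ℝ) ≤ (1/2 : ℝ) ^ (8 * T) * (1 + (1/2 : ℝ) ^ 0) ^ (wt a) := by
          have h3 : (2:ℝ) ^ (8 * T) ≤ 2 ^ (wt a) :=
            pow_le_pow_right₀ (by norm_num) (by omega)
          have h4 : (1/2 : ℝ) ^ (8 * T) * 2 ^ (8 * T) = 1 := by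
            rw [← mul_pow]; norm_num
          have h5 : (1 + (1/2 : ℝ) ^ 0) = 2 := by norm_num
          rw [h5]
          exact h4.symm.le.trans (mul_le_mul_of_nonneg_left h3 (by positivity))
        have : (0:ℝ) ≤ (1/3 : ℝ) ^ T := by positivity
        linarith
  | succ k ih =>
    have e : 8 * T * (k + 1 + 1) = 8 * T * (k + 1) + 8 * T := by ring
    rw [e]
    refine fam_step ih T (8 * T) (fun _ => 0) (fun w i => w ≤ 8 * T ∨ T ≤ i) _ ?_
      (fun w i => (if w ≤ 8 * T then 0 else
          (if i < T then 1 else if i ≤ 8 * T then 0 else (1/3 : ℝ) ^ T))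
        + (1/2 : ℝ) ^ (8 * T) * (1 + (1/2 : ℝ) ^ k) ^ i) ?_ ?_ ?_
    · intro w i h1 h2
      omega
    · intro w i h1 h2
      apply add_le_add_left
      split_ifs <;> first | omega | simp
    · intro w i h1 h2
      push Not at h2
      rw [if_neg (by omega), if_pos h2.2]
      have : (0:ℝ) ≤ (1/2 : ℝ) ^ (8 * T) * (1 + (1/2 : ℝ) ^ k) ^ i := by positivity
      linarith
    · intro w _
      rw [binE_add, binE_mul, binE_pow]
      have e2 : (1 + (1 + (1/2 : ℝ) ^ k)) / 2 = 1 + (1/2 : ℝ) ^ (k + 1) := by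
        rw [pow_succ]; ring
      rw [e2]
      apply add_le_add_left
      by_cases h : w ≤ 8 * T
      · simp only [if_pos h]
        rw [binE_const]
      · simp only [if_neg h]
        exact crossing w T (by omega)

lemma fam_low_zero (F : Type) [Field F] (n T k : ℕ) (hT : 1 ≤ T) (hk : n ≤ 2 ^ k) :
    Fam F n T (8 * (k + 1) * T) (fun _ => (1/2 : ℝ) ^ T) := by
  refine fam_mono (fam_low_aux F n T k) le_rfl (by nlinarith) ?_
  intro w hw
  have h1 : (1 + (1/2 : ℝ) ^ k) ^ w ≤ 3 := by
    have h2 : (1 + (1/2 : ℝ) ^ k) ≤ Real.exp ((1/2 : ℝ) ^ k) := by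
      have := Real.add_one_le_exp ((1/2 : ℝ) ^ k); linarith
    calc (1 + (1/2 : ℝ) ^ k) ^ w ≤ (Real.exp ((1/2 : ℝ) ^ k)) ^ w :=
          pow_le_pow_left₀ (by positivity) h2 _
      _ = Real.exp (w * (1/2 : ℝ) ^ k) := by rw [← Real.exp_nat_mul]
      _ ≤ Real.exp 1 := by
          apply Real.exp_le_exp.mpr
          have h3 : (w : ℝ) ≤ 2 ^ k := by exact_mod_cast hw.trans hk
          have h4 : (2:ℝ) ^ k * (1/2 : ℝ) ^ k = 1 := by rw [← mul_pow]; norm_num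
          exact (mul_le_mul_of_nonneg_right h3 (by positivity)).trans h4.le
      _ ≤ 3 := by have := Real.exp_one_lt_d9; linarith
  have h2 : (if w ≤ 8 * T then 0 else (1/3 : ℝ) ^ T) ≤ (1/3 : ℝ) ^ T := by
    split_ifs
    · positivity
    · exact le_rfl
  have h3 : (1/3 : ℝ) ^ T ≤ 2/3 * (1/2 : ℝ) ^ T := by
    obtain ⟨s, rfl⟩ := Nat.exists_eq_add_of_le hT
    rw [pow_add, pow_add]
    have : (1/3 : ℝ) ^ s ≤ (1/2 : ℝ) ^ s := pow_le_pow_left₀ (by norm_num) (by norm_num) _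
    linarith
  have h4 : (1/2 : ℝ) ^ (8 * T) ≤ 1/12 * (1/2 : ℝ) ^ T := by
    obtain ⟨s, rfl⟩ := Nat.exists_eq_add_of_le hT
    rw [pow_mul, pow_add, pow_add]
    have : ((1/2 : ℝ) ^ 8) ^ s ≤ (1/2 : ℝ) ^ s := pow_le_pow_left₀ (by norm_num) (by norm_num) _
    have h5 : (0:ℝ) < (1/2 : ℝ) ^ s := by positivity
    norm_num at this ⊢
    linarith
  have h5 : (1/2 : ℝ) ^ (8 * T) * (1 + (1/2 : ℝ) ^ k) ^ w ≤ (1/12 * (1/2 : ℝ) ^ T) * 3 :=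
    mul_le_mul h4 h1 (by positivity) (by positivity)
  have h6 : (0:ℝ) < (1/2 : ℝ) ^ T := by positivity
  linarith

/-! ### Going up -/

lemma chernoff (w : ℕ) (N D : ℝ) (hN : 0 < N) (hw : (w : ℝ) ≤ N) (hD : 0 ≤ D) :
    binE w (fun i => if D ≤ |2 * (i : ℝ) - w| then 1 else 0)
      ≤ 2 * Real.exp (-(D ^ 2 / (2 * N))) := by
  set l : ℝ := D / N with hl
  have hl0 : 0 ≤ l := by positivity
  have e1 : ∀ l : ℝ, binE w (fun i => Real.exp (l * (2 * (i : ℝ) - w))) = Real.cosh l ^ w := by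
    intro l
    have h1 : (fun i : ℕ => Real.exp (l * (2 * (i : ℝ) - w)))
        = fun i : ℕ => Real.exp (-l) ^ w * (Real.exp (2 * l)) ^ i := by
      funext i
      rw [← Real.exp_nat_mul, ← Real.exp_nat_mul, ← Real.exp_add]
      congr 1; ring
    rw [h1, binE_mul, binE_pow, ← mul_pow]
    congr 1
    rw [Real.cosh_eq]
    have : Real.exp (2 * l) = Real.exp l * Real.exp l := by rw [← Real.exp_add]; congr 1; ring
    have h2 : Real.exp (-l) * Real.exp l = 1 := by rw [← Real.exp_add]; simp
    rw [this]
    linear_combination (Real.exp l / 2) * h2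
  have h1 : binE w (fun i => if D ≤ |2 * (i : ℝ) - w| then 1 else 0)
      ≤ binE w (fun i => Real.exp (-(l * D)) *
        (Real.exp (l * (2 * (i : ℝ) - w)) + Real.exp ((-l) * (2 * (i : ℝ) - w)))) := by
    apply binE_mono
    intro i _
    split_ifs with h
    · rw [mul_add, ← Real.exp_add, ← Real.exp_add]
      rcases le_abs.mp h with h | h
      · have : 1 ≤ Real.exp (-(l * D) + l * (2 * (i : ℝ) - w)) := by
          apply Real.one_le_exp; nlinarith
        have := Real.exp_pos (-(l * D) + (-l) * (2 * (i : ℝ) - w))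
        linarith
      · have : 1 ≤ Real.exp (-(l * D) + (-l) * (2 * (i : ℝ) - w)) := by
          apply Real.one_le_exp; nlinarith
        have := Real.exp_pos (-(l * D) + l * (2 * (i : ℝ) - w))
        linarith
    · positivity
  refine h1.trans ?_
  rw [binE_mul, binE_add, e1, e1, Real.cosh_neg]
  have h2 : Real.cosh l ^ w ≤ Real.exp (N * (l ^ 2 / 2)) := by
    calc Real.cosh l ^ w ≤ Real.exp (l ^ 2 / 2) ^ w :=
          pow_le_pow_left₀ (Real.cosh_pos l).le (Real.cosh_le_exp_half_sq l) _
      _ = Real.exp (w * (l ^ 2 / 2)) := by rw [← Real.exp_nat_mul]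
      _ ≤ _ := Real.exp_le_exp.mpr (mul_le_mul_of_nonneg_right hw (by positivity))
  have h3 : Real.exp (-(l * D)) * Real.exp (N * (l ^ 2 / 2)) = Real.exp (-(D ^ 2 / (2 * N))) := by
    rw [← Real.exp_add, hl]
    congr 1
    field_simp
    ring
  have h4 := mul_le_mul_of_nonneg_left h2 (Real.exp_pos (-(l * D))).le
  rw [h3] at h4
  linarith

lemma exp_neg_nat_le (x : ℝ) (m : ℕ) (h : (m : ℝ) ≤ x) : Real.exp (-x) ≤ (1/2 : ℝ) ^ m := by
  have h1 : Real.exp (-1) ≤ 1/2 := by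
    have h2 := Real.exp_one_gt_d9
    rw [Real.exp_neg, inv_eq_one_div]
    exact one_div_le_one_div_of_le (by norm_num) (by linarith)
  calc Real.exp (-x) ≤ Real.exp (m * (-1)) := Real.exp_le_exp.mpr (by linarith)
    _ = Real.exp (-1) ^ m := by rw [Real.exp_nat_mul]
    _ ≤ _ := pow_le_pow_left₀ (Real.exp_pos _).le h1 _

lemma fam_up {F : Type} [Field F] {n T' d l : ℕ}
    (hF : Fam F n T' d (fun _ => (1/2 : ℝ) ^ (l + 1))) (T D : ℕ)
    (h1 : 8 * T * (l + 2) ≤ D ^ 2) (h2 : T + D ≤ 2 * T') (h3 : T' ≤ T) (h4 : 2 * (l + 2) ≤ T) :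
    Fam F n T (d + 2 * D) (fun _ => (1/2 : ℝ) ^ l) := by
  classical
  refine fam_step hF T (2 * D) (fun i => 2 * i - D)
    (fun w i => (i < T' → 2 * i - D ≤ w ∧ w ≤ 2 * i - D + 2 * D) ∧ (T' ≤ i → T ≤ w)) _ ?_
    (fun w i => (1/2 : ℝ) ^ (l + 1) +
      (if (if w ≤ 4 * T then (D : ℝ) else (w : ℝ) / 2) ≤ |2 * (i : ℝ) - w| then 1 else 0)) ?_ ?_ ?_
  · intro w i h _; exact h
  · intro w i _ _
    have : (0:ℝ) ≤ (if (if w ≤ 4 * T then (D : ℝ) else (w : ℝ) / 2) ≤ |2 * (i : ℝ) - w|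
      then 1 else 0) := by split_ifs <;> norm_num
    linarith
  · intro w i hi hn
    have hp : (0:ℝ) < (1/2 : ℝ) ^ (l + 1) := by positivity
    have key : (if w ≤ 4 * T then (D : ℝ) else (w : ℝ) / 2) ≤ |2 * (i : ℝ) - w| := by
      split_ifs with hw
      · have : 2 * i + D ≤ w ∨ w + D ≤ 2 * i := by
          by_contra hc
          exact hn ⟨fun _ => by omega, fun _ => by omega⟩
        rcases this with h | h
        · have h' : 2 * (i : ℝ) + D ≤ w := by exact_mod_cast h
          apply le_abs.mpr; right; linarith
        · have h' : (w : ℝ) + D ≤ 2 * i := by exact_mod_cast h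
          apply le_abs.mpr; left; linarith
      · have h : 4 * i ≤ w := by
          by_contra hc
          exact hn ⟨fun _ => by omega, fun _ => by omega⟩
        have h' : 4 * (i : ℝ) ≤ w := by exact_mod_cast h
        apply le_abs.mpr; right; linarith
    rw [if_pos key]
    linarith
  · intro w _
    rw [binE_add, binE_const]
    have hT0 : (0:ℝ) < T := by
      have : 0 < T := by omega
      exact_mod_cast this
    have e : (1/2 : ℝ) ^ l = (1/2 : ℝ) ^ (l + 1) + 2 * (1/2 : ℝ) ^ (l + 2) := by
      rw [pow_succ, pow_add]; ring
    rw [e]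
    apply add_le_add_right
    by_cases hw : w ≤ 4 * T
    · simp only [if_pos hw]
      refine (chernoff w (4 * T) D (by positivity) (by exact_mod_cast hw) (by positivity)).trans ?_
      apply mul_le_mul_of_nonneg_left _ (by norm_num)
      apply exp_neg_nat_le
      rw [le_div_iff₀ (by positivity)]
      have : (8:ℝ) * T * (l + 2) ≤ D ^ 2 := by exact_mod_cast h1
      push_cast
      linarith
    · simp only [if_neg hw]
      have hw' : (4:ℝ) * T ≤ w := by
        have : 4 * T ≤ w := by omega
        exact_mod_cast this
      have hw0 : (0:ℝ) < w := by linarith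
      refine (chernoff w w (w / 2) hw0 le_rfl (by positivity)).trans ?_
      apply mul_le_mul_of_nonneg_left _ (by norm_num)
      apply exp_neg_nat_le
      have h4' : (2:ℝ) * (l + 2) ≤ T := by exact_mod_cast h4
      have : ((w:ℝ) / 2) ^ 2 / (2 * w) = w / 8 := by field_simp; norm_num
      rw [this]
      push_cast
      linarith

lemma fam_main {F : Type} [Field F] {n B : ℕ} (hB : 1 ≤ B)
    (low : ∀ T, 6 ≤ T → Fam F n T (B * T) (fun _ => (1/2 : ℝ) ^ T)) :
    ∀ T l : ℕ, 8 ≤ l → ∃ d : ℕ, Fam F n T d (fun _ => (1/2 : ℝ) ^ l) ∧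
      (d : ℝ) ≤ 1000 * B * (Real.sqrt (T * l) + l) := by
  intro T
  induction T using Nat.strong_induction_on with
  | _ T ih =>
  intro l hl
  by_cases hT : T ≤ 1000 * l
  · refine ⟨B * (1000 * l), fam_mono (low (1000 * l) (by omega)) hT le_rfl ?_, ?_⟩
    · intro w _
      exact pow_le_pow_of_le_one (by norm_num) (by norm_num) (by omega)
    · push_cast
      have h1 : 0 ≤ Real.sqrt (T * l) := Real.sqrt_nonneg _
      have h2 : (0:ℝ) ≤ B := by positivity
      nlinarith [mul_nonneg h2 h1]
  · push Not at hT
    set D := Nat.sqrt (8 * T * (l + 2)) + 1 with hD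
    set T' := (T + D + 1) / 2 with hT'
    set S := Real.sqrt (T * l) with hS
    have hS0 : 0 ≤ S := Real.sqrt_nonneg _
    have hS2 : S ^ 2 = T * l := Real.sq_sqrt (by positivity)
    have hTr : (1000:ℝ) * l ≤ T := by exact_mod_cast hT.le
    have hlr : (8:ℝ) ≤ l := by exact_mod_cast hl
    have hS250 : 250 ≤ S := by
      apply Real.le_sqrt_of_sq_le
      nlinarith
    have hST : S ≤ T / 30 := by
      apply Real.sqrt_le_iff.mpr
      constructor
      · positivity
      · nlinarith
    have hD1 : (D : ℝ) ≤ 4 * S := by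
      have h1 : ((Nat.sqrt (8 * T * (l + 2)) : ℕ) : ℝ) ^ 2 ≤ 8 * T * (l + 2) := by
        exact_mod_cast Nat.sqrt_le' (8 * T * (l + 2))
      have h2 : ((Nat.sqrt (8 * T * (l + 2)) : ℕ) : ℝ) ≤ 3.2 * S := by
        apply (sq_le_sq₀ (by positivity) (by positivity)).mp
        rw [mul_pow, hS2]
        nlinarith
      rw [hD]; push_cast; linarith
    have hD2 : 8 * T * (l + 2) ≤ D ^ 2 := by
      have := Nat.lt_succ_sqrt' (8 * T * (l + 2))
      exact this.le
    have hT'r : (T' : ℝ) ≤ 0.6 * T := by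
      have h1 : 2 * T' ≤ T + D + 1 := by omega
      have h2 : 2 * (T' : ℝ) ≤ T + D + 1 := by exact_mod_cast h1
      nlinarith
    have hlt : T' < T := by
      have : (T' : ℝ) < T := by nlinarith
      exact_mod_cast this
    obtain ⟨d, hd1, hd2⟩ := ih T' hlt (l + 1) (by omega)
    refine ⟨d + 2 * D, fam_up hd1 T D hD2 (by omega) hlt.le (by omega), ?_⟩
    have h5 : Real.sqrt (T' * ((l + 1 : ℕ) : ℝ)) ≤ 0.83 * S := by
      apply Real.sqrt_le_iff.mpr
      refine ⟨by positivity, ?_⟩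
      rw [mul_pow, hS2]
      push_cast
      have h6 : (l : ℝ) + 1 ≤ 1.125 * l := by linarith
      have h7 : (T' : ℝ) * (l + 1) ≤ (0.6 * T) * (1.125 * l) :=
        mul_le_mul hT'r h6 (by positivity) (by positivity)
      have h8 : (0:ℝ) ≤ T * l := by positivity
      nlinarith
    push_cast at hd2 h5 ⊢
    have hBr : (1:ℝ) ≤ B := by exact_mod_cast hB
    have h9 : 1000 * (B:ℝ) * (Real.sqrt (T' * (l + 1)) + (l + 1))
        ≤ 1000 * B * (0.83 * S + (l + 1)) :=
      mul_le_mul_of_nonneg_left (by linarith) (by positivity)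
    nlinarith [mul_nonneg (sub_nonneg.mpr hBr) hS0]

/-! ### The low-weight family in positive characteristic -/

open Classical in
/-- the support of a vector -/
def suppV {F : Type} [Field F] {m : ℕ} (c : Fin m → F) : Finset (Fin m) :=
  Finset.univ.filter (fun b => c b ≠ 0)

/-- the potential -/
def potV {F : Type} [Field F] {m : ℕ} (c : Fin m → F) : ℝ := (1/2 : ℝ) ^ (suppV c).card

lemma potV_pos {F : Type} [Field F] {m : ℕ} (c : Fin m → F) : 0 < potV c := by
  unfold potV; positivity

lemma potV_single_zero {F : Type} [Field F] {m : ℕ} (c : Fin m → F) (b : Fin m) (h : c b = 0) :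
    potV (c + Pi.single b 1) = potV c / 2 := by
  classical
  have h1 : suppV (c + Pi.single b 1) = insert b (suppV c) := by
    ext x
    simp only [suppV, Finset.mem_filter, Finset.mem_univ, true_and, Finset.mem_insert,
      Pi.add_apply]
    by_cases hx : x = b
    · subst hx; simp [h]
    · simp [hx]
  have h2 : b ∉ suppV c := by simp [suppV, h]
  unfold potV
  rw [h1, Finset.card_insert_of_notMem h2, pow_succ]
  ring

lemma potV_single_le {F : Type} [Field F] {m : ℕ} (c : Fin m → F) (b : Fin m) :
    potV (c + Pi.single b 1) ≤ 2 * potV c := by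
  classical
  have h1 : suppV c ⊆ insert b (suppV (c + Pi.single b 1)) := by
    intro x
    simp only [suppV, Finset.mem_filter, Finset.mem_univ, true_and, Finset.mem_insert,
      Pi.add_apply]
    by_cases hx : x = b
    · simp [hx]
    · simp [hx]
  have h2 : (suppV c).card ≤ (suppV (c + Pi.single b 1)).card + 1 :=
    (Finset.card_le_card h1).trans (Finset.card_insert_le _ _)
  unfold potV
  have h3 : (1/2 : ℝ) ^ ((suppV (c + Pi.single b 1)).card + 1) ≤ (1/2 : ℝ) ^ (suppV c).card :=
    pow_le_pow_of_le_one (by norm_num) (by norm_num) h2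
  rw [pow_succ] at h3
  linarith

lemma pot_step {F : Type} [Field F] {m T : ℕ} (hm : m = 18 * T) (c : Fin m → F) :
    ∑ x : Fin m × Bool, potV (c + if x.2 then Pi.single x.1 1 else 0)
      ≤ (2 * m) * (7/8 * potV c + 2 * (1/2 : ℝ) ^ (3 * T)) := by
  classical
  rw [Fintype.sum_prod_type]
  simp only [Fintype.sum_bool, if_true, Bool.false_eq_true, if_false, add_zero]
  have hp := potV_pos c
  have h1 : ∀ b ∈ (Finset.univ : Finset (Fin m)), potV (c + Pi.single b 1) + potV c
      ≤ 3/2 * potV c + (if b ∈ suppV c then 3/2 * potV c else 0) := by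
    intro b _
    by_cases hb : c b = 0
    · rw [potV_single_zero c b hb]
      have : b ∉ suppV c := by simp [suppV, hb]
      rw [if_neg this]
      linarith
    · have : b ∈ suppV c := by simp [suppV, hb]
      rw [if_pos this]
      have := potV_single_le c b
      linarith
  refine (Finset.sum_le_sum h1).trans ?_
  rw [Finset.sum_add_distrib, Finset.sum_const, Finset.sum_ite_mem, Finset.univ_inter,
    Finset.sum_const, Finset.card_univ, Fintype.card_fin, nsmul_eq_mul, nsmul_eq_mul]
  have hZ : ((suppV c).card : ℝ) ≤ m := by
    have := Finset.card_le_univ (suppV c)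
    rw [Fintype.card_fin] at this
    exact_mod_cast this
  have hm' : (m : ℝ) = 18 * T := by exact_mod_cast hm
  have hm0 : (0:ℝ) ≤ m := by positivity
  by_cases h : (suppV c).card ≤ 3 * T
  · have h' : ((suppV c).card : ℝ) ≤ 3 * T := by exact_mod_cast h
    have h2 : ((suppV c).card : ℝ) * (3/2 * potV c) ≤ (m / 6) * (3/2 * potV c) :=
      mul_le_mul_of_nonneg_right (by linarith) (by linarith)
    have h3 : (0:ℝ) ≤ (2 * m) * (2 * (1/2 : ℝ) ^ (3 * T)) := by positivity
    nlinarith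
  · have h2 : potV c ≤ (1/2 : ℝ) ^ (3 * T) :=
      pow_le_pow_of_le_one (by norm_num) (by norm_num) (by omega)
    have h3 : ((suppV c).card : ℝ) * (3/2 * potV c) ≤ m * (3/2 * potV c) :=
      mul_le_mul_of_nonneg_right hZ (by linarith)
    have h4 : (m:ℝ) * potV c ≤ m * (1/2 : ℝ) ^ (3 * T) := mul_le_mul_of_nonneg_left h2 hm0
    have h5 := mul_nonneg hm0 hp.le
    nlinarith

/-- state of the hashing process -/
def stV (F : Type) [Field F] {n m : ℕ} (ω : Fin n → Fin m × Bool) (a : Fin n → Bool) : Fin m → F :=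
  ∑ i, if a i then (if (ω i).2 then Pi.single (ω i).1 1 else 0) else 0

lemma stV_cons (F : Type) [Field F] {n m : ℕ} (x : Fin m × Bool) (ω : Fin n → Fin m × Bool)
    (b : Bool) (a : Fin n → Bool) :
    stV F (Fin.cons x ω : Fin (n + 1) → Fin m × Bool) (Fin.cons b a : Fin (n + 1) → Bool)
      = stV F ω a + if b then (if x.2 then Pi.single x.1 1 else 0) else 0 := by
  unfold stV
  rw [Fin.sum_univ_succ, add_comm]
  simp only [Fin.cons_zero, Fin.cons_succ]

lemma pot_sum (F : Type) [Field F] {m T : ℕ} (hm : m = 18 * T) : ∀ {n : ℕ} (a : Fin n → Bool),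
    ∑ ω : Fin n → Fin m × Bool, potV (stV F ω a)
      ≤ (2 * m) ^ n * ((7/8 : ℝ) ^ (wt a) + 16 * (1/2 : ℝ) ^ (3 * T)) := by
  intro n
  induction n with
  | zero =>
    intro a
    have h0 : wt a = 0 := by simp [wt]
    have h1 : (suppV (stV F (default : Fin 0 → Fin m × Bool) a)).card = 0 := by
      simp [suppV, stV]
    rw [Fintype.sum_unique]
    simp only [potV, h1, h0, pow_zero, one_mul]
    have : (0:ℝ) < (1/2 : ℝ) ^ (3 * T) := by positivity
    linarith
  | succ n ih =>
    intro a
    rw [sum_cons]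
    obtain ⟨c, a', rfl⟩ : ∃ c a', a = (Fin.cons c a' : Fin (n + 1) → Bool) :=
      ⟨a 0, Fin.tail a, (Fin.cons_self_tail a).symm⟩
    simp only [stV_cons, wt_cons]
    have ih' := ih a'
    have hq : (0:ℝ) < (1/2 : ℝ) ^ (3 * T) := by positivity
    cases c
    · simp only [Bool.false_eq_true, if_false, add_zero, zero_add]
      rw [Finset.sum_const, Finset.card_univ, nsmul_eq_mul, Fintype.card_prod, Fintype.card_fin,
        Fintype.card_bool, pow_succ]
      push_cast
      have := mul_le_mul_of_nonneg_left ih' (by positivity : (0:ℝ) ≤ 2 * m)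
      linarith
    · simp only [if_true]
      rw [Finset.sum_comm]
      have h1 : ∀ ω ∈ (Finset.univ : Finset (Fin n → Fin m × Bool)),
          ∑ x : Fin m × Bool, potV (stV F ω a' + if x.2 then Pi.single x.1 1 else 0)
            ≤ (2 * m) * (7/8 * potV (stV F ω a') + 2 * (1/2 : ℝ) ^ (3 * T)) :=
        fun ω _ => pot_step hm _
      refine (Finset.sum_le_sum h1).trans ?_
      rw [← Finset.mul_sum, Finset.sum_add_distrib, ← Finset.mul_sum, Finset.sum_const,
        Finset.card_univ, nsmul_eq_mul]
      have hc : ((Fintype.card (Fin n → Fin m × Bool) : ℕ) : ℝ) = (2 * m) ^ n := by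
        simp [mul_comm]
      rw [hc, pow_succ, pow_add]
      have h2 : 7/8 * ∑ ω : Fin n → Fin m × Bool, potV (stV F ω a')
          + (2 * (m:ℝ)) ^ n * (2 * (1/2 : ℝ) ^ (3 * T))
          ≤ (2 * m) ^ n * ((7/8 : ℝ) ^ 1 * (7/8 : ℝ) ^ (wt a') + 16 * (1/2 : ℝ) ^ (3 * T)) := by
        linarith
      have := mul_le_mul_of_nonneg_left h2 (by positivity : (0:ℝ) ≤ 2 * m)
      linarith

/-- the linear form hashed to the bucket `b` -/
def linP (F : Type) [Field F] {n m : ℕ} (ω : Fin n → Fin m × Bool) (b : Fin m) :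
    MvPolynomial (Fin n) F :=
  ∑ i, MvPolynomial.C ((if (ω i).2 then Pi.single (ω i).1 1 else 0 : Fin m → F) b)
    * MvPolynomial.X i

lemma linP_deg (F : Type) [Field F] {n m : ℕ} (ω : Fin n → Fin m × Bool) (b : Fin m) :
    (linP F ω b).totalDegree ≤ 1 := by
  apply totalDegree_sum_le'
  intro i _
  refine (MvPolynomial.totalDegree_mul _ _).trans ?_
  simp

lemma linP_eval (F : Type) [Field F] {n m : ℕ} (ω : Fin n → Fin m × Bool) (b : Fin m)
    (a : Fin n → Bool) :
    MvPolynomial.eval (ptOf F a) (linP F ω b) = stV F ω a b := by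
  unfold linP stV
  rw [map_sum, Finset.sum_apply]
  apply Finset.sum_congr rfl
  intro i _
  rw [map_mul, MvPolynomial.eval_C, MvPolynomial.eval_X]
  unfold ptOf bF
  cases a i <;> simp

lemma stV_nat (F : Type) [Field F] {n m : ℕ} (ω : Fin n → Fin m × Bool) (b : Fin m)
    (a : Fin n → Bool) : ∃ k : ℕ, stV F ω a b = (k : F) := by
  classical
  refine ⟨∑ i, if a i then (if (ω i).2 then (if b = (ω i).1 then 1 else 0) else 0) else 0, ?_⟩
  unfold stV
  rw [Finset.sum_apply]
  push_cast
  apply Finset.sum_congr rfl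
  intro i _
  split_ifs <;> simp_all

lemma natCast_pow_pred {F : Type} [Field F] {p : ℕ} [CharP F p] (hp : p.Prime) (k : ℕ)
    (hk : (k : F) ≠ 0) : (k : F) ^ (p - 1) = 1 := by
  have : Fact p.Prime := ⟨hp⟩
  have h1 : ((k : ZMod p)) ≠ 0 := by
    intro h
    apply hk
    rw [CharP.cast_eq_zero_iff F p]
    exact (ZMod.natCast_eq_zero_iff k p).mp h
  have h2 := ZMod.pow_card_sub_one_eq_one h1
  have h3 := congrArg (ZMod.castHom (dvd_refl p) F) h2
  simpa using h3

/-- the gap polynomial -/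
def gapP (F : Type) [Field F] {n m : ℕ} (p T : ℕ) (ω : Fin n → Fin m × Bool) :
    MvPolynomial (Fin n) F :=
  ∑ v ∈ (Finset.univ : Finset (Finset (Fin m))).filter (fun v => v.card < T),
    ∏ b, if b ∈ v then linP F ω b ^ (p - 1) else 1 - linP F ω b ^ (p - 1)

lemma gapP_deg (F : Type) [Field F] {n m : ℕ} (p T : ℕ) (ω : Fin n → Fin m × Bool) :
    (gapP F p T ω).totalDegree ≤ m * (p - 1) := by
  apply totalDegree_sum_le'
  intro v _
  refine (MvPolynomial.totalDegree_finsetProd _ _).trans ?_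
  have h1 : ∀ b, (linP F ω b ^ (p - 1)).totalDegree ≤ p - 1 := by
    intro b
    refine (MvPolynomial.totalDegree_pow _ _).trans ?_
    have := Nat.mul_le_mul_left (p - 1) (linP_deg F ω b)
    linarith
  calc _ ≤ ∑ b : Fin m, (p - 1) := by
        apply Finset.sum_le_sum
        intro b _
        split_ifs
        · exact h1 b
        · refine (MvPolynomial.totalDegree_sub _ _).trans ?_
          simp [h1 b]
    _ = m * (p - 1) := by simp

lemma gapP_eval (F : Type) [Field F] {n m : ℕ} {p : ℕ} [CharP F p] (hp : p.Prime) (T : ℕ)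
    (ω : Fin n → Fin m × Bool) (a : Fin n → Bool) :
    MvPolynomial.eval (ptOf F a) (gapP F p T ω)
      = if (suppV (stV F ω a)).card < T then 1 else 0 := by
  classical
  unfold gapP
  rw [map_sum]
  have h1 : ∀ b, MvPolynomial.eval (ptOf F a) (linP F ω b ^ (p - 1))
      = if b ∈ suppV (stV F ω a) then 1 else 0 := by
    intro b
    rw [map_pow, linP_eval]
    obtain ⟨k, hk⟩ := stV_nat F ω b a
    by_cases h : stV F ω a b = 0
    · have : b ∉ suppV (stV F ω a) := by simp [suppV, h]
      rw [if_neg this, h, zero_pow]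
      have := hp.two_le
      omega
    · have : b ∈ suppV (stV F ω a) := by simp [suppV, h]
      rw [if_pos this, hk]
      exact natCast_pow_pred hp k (hk ▸ h)
  have h2 : ∀ v ∈ (Finset.univ : Finset (Finset (Fin m))).filter (fun v => v.card < T),
      MvPolynomial.eval (ptOf F a)
        (∏ b, if b ∈ v then linP F ω b ^ (p - 1) else 1 - linP F ω b ^ (p - 1))
      = if v = suppV (stV F ω a) then 1 else 0 := by
    intro v _
    rw [map_prod]
    split_ifs with h
    · apply Finset.prod_eq_one
      intro b _
      split_ifs with hb
      · rw [h1, if_pos (h ▸ hb)]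
      · rw [map_sub, h1, if_neg (h ▸ hb)]; simp
    · have : ∃ b, ¬ (b ∈ v ↔ b ∈ suppV (stV F ω a)) := by
        by_contra hc
        push Not at hc
        exact h (Finset.ext hc)
      obtain ⟨b, hb⟩ := this
      apply Finset.prod_eq_zero (Finset.mem_univ b)
      split_ifs with hbv
      · rw [h1, if_neg (fun h' => hb ⟨fun _ => h', fun _ => hbv⟩)]
      · have : b ∈ suppV (stV F ω a) := by tauto
        rw [map_sub, h1, if_pos this]; simp
  rw [Finset.sum_congr rfl h2, Finset.sum_ite_eq']
  simp

lemma suppV_stV_card_le (F : Type) [Field F] {n m : ℕ} (ω : Fin n → Fin m × Bool)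
    (a : Fin n → Bool) : (suppV (stV F ω a)).card ≤ wt a := by
  classical
  have : suppV (stV F ω a) ⊆ (Finset.univ.filter (fun i => a i = true)).image (fun i => (ω i).1) := by
    intro b hb
    by_contra hc
    simp only [Finset.mem_image, Finset.mem_filter, Finset.mem_univ, true_and, not_exists,
      not_and] at hc
    simp only [suppV, Finset.mem_filter, Finset.mem_univ, true_and] at hb
    apply hb
    unfold stV
    rw [Finset.sum_apply]
    apply Finset.sum_eq_zero
    intro i _
    by_cases ha : a i = true
    · have := hc i ha
      rw [if_pos ha]
      split_ifs
      · exact Pi.single_eq_of_ne (fun h => this h.symm) _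
      · rfl
    · rw [if_neg ha]; rfl
  exact (Finset.card_le_card this).trans Finset.card_image_le

lemma num_aux (T w : ℕ) (hT : 6 ≤ T) (hw : 18 * T ≤ w) :
    2 ^ T * ((7/8 : ℝ) ^ w + 16 * (1/2 : ℝ) ^ (3 * T)) ≤ (1/2 : ℝ) ^ T := by
  have h1 : (7/8 : ℝ) ^ w ≤ (7/8 : ℝ) ^ (18 * T) :=
    pow_le_pow_of_le_one (by norm_num) (by norm_num) hw
  have h2 : (7/8 : ℝ) ^ (18 * T) ≤ (1/8 : ℝ) ^ T := by
    rw [pow_mul]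
    exact pow_le_pow_left₀ (by norm_num) (by norm_num) _
  have h3 : (1/2 : ℝ) ^ (3 * T) = (1/8 : ℝ) ^ T := by
    rw [pow_mul]; norm_num
  have h4 : (2:ℝ) ^ T * (1/8 : ℝ) ^ T = (1/2 : ℝ) ^ T * (1/2 : ℝ) ^ T := by
    rw [← mul_pow, ← mul_pow]; norm_num
  have h5 : (1/2 : ℝ) ^ T ≤ (1/2 : ℝ) ^ 6 :=
    pow_le_pow_of_le_one (by norm_num) (by norm_num) hT
  have h6 : (0:ℝ) < (1/2 : ℝ) ^ T := by positivity
  have h7 : (0:ℝ) < (2:ℝ) ^ T := by positivity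
  rw [h3]
  calc 2 ^ T * ((7/8 : ℝ) ^ w + 16 * (1/8 : ℝ) ^ T)
      ≤ 2 ^ T * (17 * (1/8 : ℝ) ^ T) := mul_le_mul_of_nonneg_left (by linarith) h7.le
    _ = 17 * (1/2 : ℝ) ^ T * (1/2 : ℝ) ^ T := by linear_combination 17 * h4
    _ ≤ 1 * (1/2 : ℝ) ^ T := by
        apply mul_le_mul_of_nonneg_right _ h6.le
        norm_num at h5 ⊢
        linarith
    _ = _ := one_mul _

lemma fam_low_p (F : Type) [Field F] {p : ℕ} [CharP F p] (hp : p.Prime) (n T : ℕ) (hT : 6 ≤ T) :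
    Fam F n T (18 * p * T) (fun _ => (1/2 : ℝ) ^ T) := by
  classical
  choose A hA1 hA2 using fun (j : ℕ) =>
    interp_poly (F := F) n (18 * T) 0 (fun w => if w = j then 1 else 0)
  have : NeZero (18 * T) := ⟨by omega⟩
  refine ⟨Fin n → Fin (18 * T) × Bool, inferInstance, inferInstance,
    fun ω j => A j * gapP F p T ω, ?_, ?_⟩
  · intro ω j
    refine (MvPolynomial.totalDegree_mul _ _).trans ?_
    refine (add_le_add (hA1 j) (gapP_deg F p T ω)).trans ?_
    obtain ⟨q, rfl⟩ := Nat.exists_eq_add_of_le hp.one_le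
    rw [Nat.add_sub_cancel_left]
    nlinarith
  · intro a
    have good : ∀ ω : Fin n → Fin (18 * T) × Bool,
        (wt a ≤ 18 * T ∨ ¬ (suppV (stV F ω a)).card < T) →
        GoodAt T (fun j => A j * gapP F p T ω) a := by
      intro ω h j hj
      simp only [map_mul]
      rw [gapP_eval F hp]
      have hle := suppV_stV_card_le F ω a
      by_cases h1 : wt a < T
      · rw [hA2 j a (by omega) (by omega), if_pos (by omega : (suppV (stV F ω a)).card < T), mul_one]
      · rw [if_neg (by omega : ¬ wt a = j)]
        by_cases h2 : wt a ≤ 18 * T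
        · rw [hA2 j a (by omega) (by omega), if_neg (by omega : ¬ wt a = j), zero_mul]
        · rw [if_neg (by tauto), mul_zero]
    by_cases hw : wt a ≤ 18 * T
    · have : Finset.univ.filter (fun ω : Fin n → Fin (18 * T) × Bool =>
          ¬ GoodAt T (fun j => A j * gapP F p T ω) a) = ∅ := by
        apply Finset.filter_eq_empty_iff.mpr
        intro ω _
        rw [not_not]
        exact good ω (Or.inl hw)
      rw [this]
      simp only [Finset.card_empty, Nat.cast_zero]
      positivity
    · have h1 : ((Finset.univ.filter (fun ω : Fin n → Fin (18 * T) × Bool =>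
          ¬ GoodAt T (fun j => A j * gapP F p T ω) a)).card : ℝ)
          ≤ ∑ ω : Fin n → Fin (18 * T) × Bool, 2 ^ T * potV (stV F ω a) := by
        rw [Finset.card_filter]
        push_cast
        apply Finset.sum_le_sum
        intro ω _
        have hp := potV_pos (stV F ω a)
        by_cases h : (suppV (stV F ω a)).card < T
        · have h2 : (1/2 : ℝ) ^ T ≤ potV (stV F ω a) :=
            pow_le_pow_of_le_one (by norm_num) (by norm_num) h.le
          have h3 : (2:ℝ) ^ T * (1/2 : ℝ) ^ T = 1 := by rw [← mul_pow]; norm_num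
          have h4 := mul_le_mul_of_nonneg_left h2 (by positivity : (0:ℝ) ≤ 2 ^ T)
          split_ifs <;> linarith
        · rw [if_neg (not_not.mpr (good ω (Or.inr h)))]
          positivity
      refine h1.trans ?_
      rw [← Finset.mul_sum]
      have h2 := pot_sum F (T := T) rfl a
      have h3 := num_aux T (wt a) hT (by omega)
      have hc : ((Fintype.card (Fin n → Fin (18 * T) × Bool) : ℕ) : ℝ)
          = (2 * ((18 * T : ℕ) : ℝ)) ^ n := by
        simp [mul_comm]
      rw [hc]
      have h4 := mul_le_mul_of_nonneg_left h2 (by positivity : (0:ℝ) ≤ 2 ^ T)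
      have h5 := mul_le_mul_of_nonneg_left h3
        (by positivity : (0:ℝ) ≤ (2 * ((18 * T : ℕ) : ℝ)) ^ n)
      linarith

/-! ### From families to probabilistic degree -/

lemma pdeg_le_of_fam {F : Type} [Field F] {n t d : ℕ} {η : ℝ}
    (hF : Fam F n t d (fun _ => η)) (ht : t ≤ n) (f : (Fin n → Bool) → Bool) (spec : ℕ → Bool)
    (hf : ∀ a, f a = spec (wt a))
    (hs : ∀ i j, t ≤ i → i ≤ n → t ≤ j → j ≤ n → spec i = spec j)
    (ε : ℝ) (hε : η ≤ ε) : pdeg F f ε ≤ d := by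
  classical
  obtain ⟨Ω, _, _, E, hd, hE⟩ := hF
  apply Nat.sInf_le
  let e : Fin (Fintype.card Ω) ≃ Ω := (Fintype.equivFin Ω).symm
  have hc0 : (0:ℝ) < Fintype.card Ω := by exact_mod_cast Fintype.card_pos
  let Q : Ω → MvPolynomial (Fin n) F := fun ω => MvPolynomial.C (bF F (spec n)) +
    ∑ j ∈ Finset.range t, MvPolynomial.C (bF F (spec j) - bF F (spec n)) * E ω j
  refine ⟨⟨Fintype.card Ω, fun _ => 1 / Fintype.card Ω, fun _ => by positivity, ?_,
    fun i => Q (e i)⟩, ?_, ?_⟩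
  · rw [Finset.sum_const, Finset.card_univ, Fintype.card_fin, nsmul_eq_mul]
    field_simp
  · intro i
    simp only [Q]
    refine (MvPolynomial.totalDegree_add _ _).trans ?_
    rw [MvPolynomial.totalDegree_C]
    apply max_le (Nat.zero_le _)
    apply totalDegree_sum_le'
    intro j _
    refine (MvPolynomial.totalDegree_mul _ _).trans ?_
    rw [MvPolynomial.totalDegree_C, zero_add]
    exact hd _ _
  · intro a
    have good : ∀ ω, GoodAt t (E ω) a →
        MvPolynomial.eval (fun v => bF F (a v)) (Q ω) = bF F (f a) := by
      intro ω h
      change MvPolynomial.eval (ptOf F a) (Q ω) = _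
      simp only [Q]
      rw [map_add, map_sum, MvPolynomial.eval_C, hf]
      have h4 : ∀ j ∈ Finset.range t,
          MvPolynomial.eval (ptOf F a) (MvPolynomial.C (bF F (spec j) - bF F (spec n)) * E ω j)
            = if wt a = j then bF F (spec j) - bF F (spec n) else 0 := by
        intro j hj
        rw [map_mul, MvPolynomial.eval_C, h j (Finset.mem_range.mp hj)]
        split_ifs <;> simp
      rw [Finset.sum_congr rfl h4, Finset.sum_ite_eq]
      split_ifs with h5
      · ring
      · rw [hs (wt a) n (by simpa using h5) (wt_le a) ht le_rfl]; ring
    unfold errAt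
    simp only
    calc _ ≤ ∑ i : Fin (Fintype.card Ω),
          (fun ω => if ¬ GoodAt t (E ω) a then 1 / (Fintype.card Ω : ℝ) else 0) (e i) := by
          apply Finset.sum_le_sum
          intro i _
          by_cases h : GoodAt t (E (e i)) a
          · rw [if_pos (good _ h)]
            simp [h]
          · simp only [if_pos h]
            split_ifs
            · positivity
            · exact le_rfl
      _ = ∑ ω, if ¬ GoodAt t (E ω) a then 1 / (Fintype.card Ω : ℝ) else 0 :=
          Equiv.sum_comp e (fun ω => if ¬ GoodAt t (E ω) a then 1 / (Fintype.card Ω : ℝ) else 0)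
      _ = ((Finset.univ.filter (fun ω => ¬ GoodAt t (E ω) a)).card : ℝ)
            * (1 / (Fintype.card Ω : ℝ)) := by
          rw [← Finset.sum_filter, Finset.sum_const, nsmul_eq_mul]
      _ ≤ η * Fintype.card Ω * (1 / (Fintype.card Ω : ℝ)) :=
          mul_le_mul_of_nonneg_right (hE a) (by positivity)
      _ = η := by field_simp
      _ ≤ ε := hε

lemma pdeg_bound {F : Type} [Field F] {n B t : ℕ} (hB : 1 ≤ B)
    (low : ∀ T, 6 ≤ T → Fam F n T (B * T) (fun _ => (1/2 : ℝ) ^ T))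
    (ht : t ≤ n) (f : (Fin n → Bool) → Bool) (spec : ℕ → Bool)
    (hf : ∀ a, f a = spec (wt a))
    (hs : ∀ i j, t ≤ i → i ≤ n → t ≤ j → j ≤ n → spec i = spec j)
    (ε : ℝ) (h0 : 0 < ε) (h1 : ε < 1/3) :
    (pdeg F f ε : ℝ)
      ≤ 8000 * B * (Real.sqrt (t * Real.logb 2 (1/ε)) + Real.logb 2 (1/ε)) := by
  set L := Real.logb 2 (1/ε) with hL
  have h2 : 2 < 1 / ε := by rw [lt_div_iff₀ h0]; linarith
  have hL1 : 1 ≤ L := by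
    rw [hL, Real.le_logb_iff_rpow_le (by norm_num) (by positivity)]
    simpa using h2.le
  set l := max 8 ⌈L⌉₊ with hl
  have hl1 : L ≤ l := (Nat.le_ceil L).trans (by exact_mod_cast le_max_right _ _)
  have hl2 : (l : ℝ) ≤ 8 * L := by
    rw [hl]
    push_cast
    apply max_le
    · linarith
    · have := Nat.ceil_lt_add_one (by linarith : 0 ≤ L)
      linarith
  obtain ⟨d, hd1, hd2⟩ := fam_main hB low t l (le_max_left _ _)
  have hη : (1/2 : ℝ) ^ l ≤ ε := by
    have h3 : 1 / ε ≤ 2 ^ l := by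
      rw [hL, Real.logb_le_iff_le_rpow (by norm_num) (by positivity)] at hl1
      rwa [Real.rpow_natCast] at hl1
    rw [div_pow, one_pow]
    rw [div_le_iff₀ h0] at h3
    rw [div_le_iff₀ (by positivity)]
    linarith
  have h4 := pdeg_le_of_fam hd1 ht f spec hf hs ε hη
  have h5 : (pdeg F f ε : ℝ) ≤ d := by exact_mod_cast h4
  have h6 : Real.sqrt (t * l) ≤ 8 * Real.sqrt (t * L) := by
    apply Real.sqrt_le_iff.mpr
    refine ⟨by positivity, ?_⟩
    rw [mul_pow, Real.sq_sqrt (by positivity)]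
    have h7 := mul_le_mul_of_nonneg_left hl2 (by positivity : (0:ℝ) ≤ t)
    have h8 : 0 ≤ (t:ℝ) * L := by positivity
    linarith
  have h9 : 1000 * (B:ℝ) * (Real.sqrt (t * l) + l) ≤ 1000 * B * (8 * Real.sqrt (t * L) + 8 * L) :=
    mul_le_mul_of_nonneg_left (by linarith) (by positivity)
  linarith

/-- upper bound on the probabilistic degree of `t`-constant
symmetric Boolean functions, over positive characteristic (i) and
characteristic 0 (ii). -/
theorem stmt1 :
    (∀ p : ℕ, p.Prime →
      ∃ C : ℝ, 0 < C ∧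
        ∀ (F : Type) [Field F] [CharP F p],
          ∀ n : ℕ, 1 ≤ n → ∀ t : ℕ, t ≤ n →
            ∀ (f : (Fin n → Bool) → Bool) (spec : ℕ → Bool),
              (∀ a, f a = spec (wt a)) →
              (∀ i j, t ≤ i → i ≤ n → t ≤ j → j ≤ n → spec i = spec j) →
              ∀ ε : ℝ, 0 < ε → ε < 1/3 →
                (pdeg F f ε : ℝ)
                  ≤ C * (Real.sqrt (t * Real.logb 2 (1/ε)) + Real.logb 2 (1/ε)))
    ∧
    (∃ C : ℝ, 0 < C ∧
      ∀ (F : Type) [Field F] [CharP F 0],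
        ∀ n : ℕ, 2 ≤ n → ∀ t : ℕ, t ≤ n →
          ∀ (f : (Fin n → Bool) → Bool) (spec : ℕ → Bool),
            (∀ a, f a = spec (wt a)) →
            (∀ i j, t ≤ i → i ≤ n → t ≤ j → j ≤ n → spec i = spec j) →
            ∀ ε : ℝ, 0 < ε → ε < 1/3 →
              (pdeg F f ε : ℝ)
                ≤ C * Real.logb 2 n *
                    (Real.sqrt (t * Real.logb 2 (1/ε)) + Real.logb 2 (1/ε))) := by

  constructor
  · intro p hp
    have hp1 : (1:ℝ) ≤ p := by exact_mod_cast hp.one_le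
    refine ⟨8000 * (18 * p), by positivity, ?_⟩
    intro F _ _ n hn t ht f spec hf hs ε h0 h1
    have := pdeg_bound (F := F) (B := 18 * p) (by have := hp.one_le; omega)
      (fun T hT => fam_low_p F hp n T hT) ht f spec hf hs ε h0 h1
    push_cast at this
    exact this
  · refine ⟨8000 * 24, by norm_num, ?_⟩
    intro F _ _ n hn t ht f spec hf hs ε h0 h1
    have hb := pdeg_bound (F := F) (B := 8 * (Nat.clog 2 n + 1)) (by omega)
      (fun T hT => fam_low_zero F n T (Nat.clog 2 n) (by omega) (Nat.le_pow_clog (by norm_num) n))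
      ht f spec hf hs ε h0 h1
    refine hb.trans ?_
    have hL0 : 0 ≤ Real.logb 2 (1/ε) := by
      apply Real.logb_nonneg (by norm_num)
      rw [le_div_iff₀ h0]; linarith
    apply mul_le_mul_of_nonneg_right _ (by positivity)
    have hn2 : (2:ℝ) ≤ n := by exact_mod_cast hn
    have hlog1 : 1 ≤ Real.logb 2 n := by
      rw [Real.le_logb_iff_rpow_le (by norm_num) (by linarith)]
      simpa using hn2
    have hclog : (Nat.clog 2 n : ℝ) ≤ Real.logb 2 n + 1 := by
      have h3 : 2 ^ (Nat.clog 2 n - 1) < n := Nat.pow_pred_clog_lt_self (by norm_num) (by omega)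
      have h4 : (2:ℝ) ^ (Nat.clog 2 n - 1) ≤ n := by exact_mod_cast h3.le
      have h5 : ((Nat.clog 2 n - 1 : ℕ) : ℝ) ≤ Real.logb 2 n := by
        rw [Real.le_logb_iff_rpow_le (by norm_num) (by linarith), Real.rpow_natCast]
        exact h4
      have h6 : Nat.clog 2 n ≤ (Nat.clog 2 n - 1) + 1 := by omega
      have h7 : (Nat.clog 2 n : ℝ) ≤ ((Nat.clog 2 n - 1 : ℕ) : ℝ) + 1 := by exact_mod_cast h6
      linarith
    push_cast
    linarith
end
end

section
/- Let F be a field of characteristic p > 0. There is a constant C_p > 0 depending only on p such that for every n ≥ 1, every symmetric Boolean function f : {0,1}^n → {0,1} with standard decomposition (g,h) in which per(g) is a power of p (possibly per(g) = 1), and every ε ∈ (0,1/3), pdeg^F_ε(f) ≤ C_p · min{ √(n·log(1/ε)), per(g) + √(B(h)·log(1/ε)) + log(1/ε) }. -/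
noncomputable section

open scoped BigOperators

/-- `V` has degree at most `d`: every function of `V` is a polynomial of degree at most `d`. -/
def DegLE (F : Type) [Field F] {n : ℕ} {α : Type} (V : (Fin n → Bool) → α) (d : ℕ) : Prop :=
  ∀ s : α → F, ∃ P : MvPolynomial (Fin n) F, P.totalDegree ≤ d ∧
    ∀ a, MvPolynomial.eval (fun v => bF F (a v)) P = s (V a)

lemma DegLE.mono {F : Type} [Field F] {n : ℕ} {α : Type} {V : (Fin n → Bool) → α} {d e : ℕ}
    (h : DegLE F V d) (hde : d ≤ e) : DegLE F V e := by
  intro s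
  obtain ⟨P, h1, h2⟩ := h s
  exact ⟨P, h1.trans hde, h2⟩

lemma DegLE.comp {F : Type} [Field F] {n : ℕ} {α β : Type} {V : (Fin n → Bool) → α} {d : ℕ}
    (h : DegLE F V d) (g : α → β) : DegLE F (fun a => g (V a)) d :=
  fun s => h (fun x => s (g x))

lemma DegLE.prod {F : Type} [Field F] {n : ℕ} {α β : Type} {V : (Fin n → Bool) → α}
    {W : (Fin n → Bool) → β} {d e : ℕ}
    (h : DegLE F V d) (h' : DegLE F W e) : DegLE F (fun a => (V a, W a)) (d + e) := by
  classical
  intro s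
  choose P hP1 hP2 using fun r : α => h (fun x => if x = r then 1 else 0)
  choose Q hQ1 hQ2 using fun r : α => h' (fun y => s (r, y))
  refine ⟨∑ r ∈ Finset.univ.image V, P r * Q r, ?_, ?_⟩
  · refine MvPolynomial.totalDegree_finsetSum_le ?_
    intro r _
    exact (MvPolynomial.totalDegree_mul _ _).trans (add_le_add (hP1 r) (hQ1 r))
  · intro a
    rw [map_sum, Finset.sum_eq_single (V a)]
    · simp [hP2, hQ2]
    · intro r _ hr
      simp [hP2, hr.symm]
    · intro h0
      exact absurd (Finset.mem_image_of_mem V (Finset.mem_univ a)) h0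

lemma DegLE.pi {F : Type} [Field F] {n : ℕ} {α : Type} {d : ℕ} :
    ∀ (L : ℕ) (V : Fin L → (Fin n → Bool) → α), (∀ j, DegLE F (V j) d) →
      DegLE F (fun a j => V j a) (L * d) := by
  intro L
  induction L with
  | zero =>
    intro V _ s
    refine ⟨MvPolynomial.C (s finZeroElim), by simp, ?_⟩
    intro a
    simp only [MvPolynomial.eval_C]
    congr 1
    exact Subsingleton.elim _ _
  | succ L ih =>
    intro V hV
    have h1 := (hV 0).prod (ih (fun j => V j.succ) (fun j => hV j.succ))
    have h2 := h1.comp (fun x : α × (Fin L → α) => (Fin.cons x.1 x.2 : Fin (L+1) → α))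
    refine (?_ : DegLE F _ _).mono (show d + L * d ≤ (L+1) * d by ring_nf; rfl)
    convert h2 using 1
    funext a j
    refine Fin.cases ?_ (fun i => ?_) j <;> simp

/-- the number of `i ∈ S` with `a i = b` -/
def cnt {n : ℕ} (b : Bool) (S : Finset (Fin n)) (a : Fin n → Bool) : ℕ :=
  (S.filter fun i => a i = b).card

lemma eval_esymm (F : Type) [Field F] {n : ℕ} (S : Finset (Fin n)) (j : ℕ) (a : Fin n → Bool) :
    MvPolynomial.eval (fun v => bF F (a v))
      (∑ T ∈ S.powersetCard j, ∏ i ∈ T, (MvPolynomial.X i : MvPolynomial (Fin n) F))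
      = ((cnt true S a).choose j : F) := by
  classical
  have h : ∀ T : Finset (Fin n), (∏ i ∈ T, bF F (a i)) = if (∀ i ∈ T, a i = true) then 1 else 0 := by
    intro T
    unfold bF
    rw [Finset.prod_ite_zero]
    simp
  simp only [map_sum, map_prod, MvPolynomial.eval_X, h]
  rw [Finset.sum_ite, Finset.sum_const_zero, add_zero, Finset.sum_const, nsmul_eq_mul, mul_one]
  unfold cnt
  rw [← Finset.card_powersetCard]
  congr 2
  ext T
  simp only [Finset.mem_filter, Finset.mem_powersetCard, Finset.subset_iff]
  grind

lemma choose_add_pow_cast (F : Type) [Field F] (p : ℕ) [CharP F p] (hp : p.Prime) (t w j : ℕ)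
    (hj : j < p ^ t) : ((w + p ^ t).choose j : F) = (w.choose j : F) := by
  rw [Nat.add_choose_eq]
  push_cast
  rw [Finset.sum_eq_single (j, 0)]
  · simp
  · rintro ⟨x, y⟩ hxy hne
    rw [Finset.HasAntidiagonal.mem_antidiagonal] at hxy
    simp only at hxy
    have hy0 : y ≠ 0 := by
      rintro rfl
      apply hne
      simp at hxy
      simp [hxy]
    have : p ∣ (p ^ t).choose y := hp.dvd_choose_pow hy0 (by omega)
    simp [(CharP.cast_eq_zero_iff F p _).2 this]
  · simp

lemma choose_mod_pow_cast (F : Type) [Field F] (p : ℕ) [CharP F p] (hp : p.Prime) (t w j : ℕ)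
    (hj : j < p ^ t) : ((w % p ^ t).choose j : F) = (w.choose j : F) := by
  have h : ∀ q r : ℕ, ((r + p ^ t * q).choose j : F) = (r.choose j : F) := by
    intro q r
    induction q with
    | zero => simp
    | succ q ih => rw [mul_add, mul_one, ← add_assoc, choose_add_pow_cast F p hp t _ _ hj, ih]
  conv_rhs => rw [← Nat.mod_add_div w (p ^ t)]
  rw [h]

lemma degLE_cnt_true (F : Type) [Field F] (p : ℕ) [CharP F p] (hp : p.Prime) (t : ℕ) {n : ℕ}
    (S : Finset (Fin n)) : DegLE F (fun a => cnt true S a % p ^ t) (p ^ t) := by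
  intro s
  refine ⟨∑ j ∈ Finset.range (p ^ t), MvPolynomial.C ((fwdDiff 1)^[j] s 0) *
    ∑ T ∈ S.powersetCard j, ∏ i ∈ T, (MvPolynomial.X i : MvPolynomial (Fin n) F), ?_, ?_⟩
  · refine MvPolynomial.totalDegree_finsetSum_le ?_
    intro j hj
    refine (MvPolynomial.totalDegree_mul _ _).trans ?_
    rw [MvPolynomial.totalDegree_C, zero_add]
    refine MvPolynomial.totalDegree_finsetSum_le ?_
    intro T hT
    refine (MvPolynomial.totalDegree_finsetProd _ _).trans ?_
    simp only [MvPolynomial.totalDegree_X, Finset.sum_const, smul_eq_mul, mul_one]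
    rw [(Finset.mem_powersetCard.1 hT).2]
    exact (Finset.mem_range.1 hj).le
  · intro a
    rw [map_sum]
    simp only [map_mul, MvPolynomial.eval_C, eval_esymm]
    set w := cnt true S a
    have hlt : w % p ^ t < p ^ t := Nat.mod_lt _ (pow_pos hp.pos t)
    have h := shift_eq_sum_fwdDiff_iter 1 s (w % p ^ t) 0
    simp only [smul_eq_mul, mul_one, zero_add] at h
    rw [h]
    rw [Finset.sum_subset (Finset.range_subset_range.2 hlt)]
    · refine Finset.sum_congr rfl fun j hj => ?_
      rw [nsmul_eq_mul, choose_mod_pow_cast F p hp t _ _ (Finset.mem_range.1 hj), mul_comm]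
    · intro j _ hj
      rw [Finset.mem_range, not_lt] at hj
      rw [Nat.choose_eq_zero_of_lt (by omega), zero_smul]

lemma cnt_add {n : ℕ} (S : Finset (Fin n)) (a : Fin n → Bool) :
    cnt true S a + cnt false S a = S.card := by
  unfold cnt
  rw [← Finset.card_filter_add_card_filter_not (s := S) (fun i => a i = true)]
  simp

lemma degLE_cnt (F : Type) [Field F] (p : ℕ) [CharP F p] (hp : p.Prime) (t : ℕ) {n : ℕ}
    (b : Bool) (S : Finset (Fin n)) : DegLE F (fun a => cnt b S a % p ^ t) (p ^ t) := by
  cases b with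
  | true => exact degLE_cnt_true F p hp t S
  | false =>
    have h := (degLE_cnt_true F p hp t S).comp
      (fun r => (((S.card : ℤ) - (r : ℤ)) % ((p ^ t : ℕ) : ℤ)).toNat)
    convert h using 1
    funext a
    have := cnt_add S a
    have h2 : (cnt false S a : ℤ) = S.card - cnt true S a := by omega
    zify
    rw [Int.toNat_of_nonneg (Int.emod_nonneg _ (by exact_mod_cast (pow_pos hp.pos t).ne')), h2]
    rw [Int.sub_emod_emod]

lemma degLE_id (F : Type) [Field F] {n : ℕ} : DegLE F (fun a : Fin n → Bool => a) n := by
  have h : ∀ j : Fin n, DegLE F (fun a : Fin n → Bool => a j) 1 := by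
    intro j s
    refine ⟨MvPolynomial.C (s false) + MvPolynomial.C (s true - s false) * MvPolynomial.X j, ?_, ?_⟩
    · refine (MvPolynomial.totalDegree_add _ _).trans ?_
      rw [MvPolynomial.totalDegree_C]
      refine max_le (by omega) ?_
      refine (MvPolynomial.totalDegree_mul _ _).trans ?_
      rw [MvPolynomial.totalDegree_C, zero_add, MvPolynomial.totalDegree_X]
    · intro a
      cases h : a j <;> simp [bF, h]
  simpa using DegLE.pi n (fun j (a : Fin n → Bool) => a j) h

lemma mgf {n : ℕ} (N : ℕ) (A : Finset (Fin n)) (z : ℝ) :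
    ∑ ω : Fin n → Fin (N + 1), z ^ (A.filter fun i => ω i = 0).card
      = (1 + (z - 1) / (N + 1)) ^ A.card * ((N : ℝ) + 1) ^ n := by
  classical
  have h1 : ∀ ω : Fin n → Fin (N + 1), z ^ (A.filter fun i => ω i = 0).card
      = ∏ i, (if i ∈ A then (if ω i = 0 then z else 1) else 1) := by
    intro ω
    rw [Finset.prod_ite_mem, Finset.univ_inter, Finset.prod_ite, Finset.prod_const]
    simp
  simp only [h1]
  rw [← Fintype.prod_sum (fun (i : Fin n) (j : Fin (N+1)) =>
    (if i ∈ A then (if j = 0 then z else 1) else (1:ℝ)))]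
  have h2 : ∀ i : Fin n, (∑ j : Fin (N+1), (if i ∈ A then (if j = 0 then z else 1) else (1:ℝ)))
      = (if i ∈ A then (1 + (z - 1) / (N + 1)) else 1) * ((N:ℝ) + 1) := by
    intro i
    have : (N:ℝ) + 1 ≠ 0 := by positivity
    by_cases hi : i ∈ A
    · simp only [hi, if_true]
      rw [Fin.sum_univ_succ]
      simp
      field_simp
      ring
    · simp [hi]
  simp only [h2]
  rw [Finset.prod_mul_distrib, Finset.prod_ite_mem, Finset.univ_inter, Finset.prod_const,
    Finset.prod_const]
  simp

lemma tail_up {n : ℕ} (A : Finset (Fin n)) (k δ : ℝ) (hk : 0 < k) (hδ : 0 ≤ δ) (hδk : δ ≤ k)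
    (hA : (A.card : ℝ) ≤ 2 * k) :
    (∑ ω : Fin n → Fin 4, if (A.card : ℝ) / 4 + δ ≤ ((A.filter fun i => ω i = 0).card : ℝ)
      then (1:ℝ) else 0) ≤ Real.exp (-(δ ^ 2 / (2 * k))) * 4 ^ n := by
  set l := δ / k with hl
  have hl0 : 0 ≤ l := by positivity
  have hl1 : l ≤ 1 := by rw [hl, div_le_one hk]; exact hδk
  have hlk : l * k = δ := by rw [hl]; field_simp
  set w : ℝ := (A.card : ℝ)
  have step : ∀ ω : Fin n → Fin 4, (if w / 4 + δ ≤ ((A.filter fun i => ω i = 0).card : ℝ)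
      then (1:ℝ) else 0) ≤ Real.exp (-(l * (w / 4 + δ))) *
        (Real.exp l) ^ (A.filter fun i => ω i = 0).card := by
    intro ω
    split_ifs with h
    · rw [← Real.exp_nat_mul, ← Real.exp_add]
      apply Real.one_le_exp
      nlinarith
    · positivity
  refine (Finset.sum_le_sum fun ω _ => step ω).trans ?_
  rw [← Finset.mul_sum]
  have := mgf 3 A (Real.exp l)
  norm_num at this
  rw [this, ← mul_assoc]
  gcongr
  have h1 : Real.exp l ≤ 1 + l + l ^ 2 := by
    have := (abs_le.1 (Real.abs_exp_sub_one_sub_id_le (x := l) (by rw [abs_of_nonneg hl0]; exact hl1))).2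
    linarith
  have h0 : 1 ≤ Real.exp l := Real.one_le_exp hl0
  have h2 : 1 + (Real.exp l - 1) / 4 ≤ Real.exp ((l + l ^ 2) / 4) := by
    have := Real.add_one_le_exp ((l + l ^ 2) / 4)
    linarith
  calc Real.exp (-(l * (w / 4 + δ))) * (1 + (Real.exp l - 1) / 4) ^ A.card
      ≤ Real.exp (-(l * (w / 4 + δ))) * (Real.exp ((l + l ^ 2) / 4)) ^ A.card := by
        gcongr
    _ = Real.exp (-(l * (w / 4 + δ)) + w * ((l + l ^ 2) / 4)) := by
        rw [← Real.exp_nat_mul, ← Real.exp_add]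
    _ ≤ _ := by
        apply Real.exp_le_exp.2
        have e : δ ^ 2 / (2 * k) = l * δ / 2 := by rw [hl]; field_simp
        rw [e]
        have : w * l ^ 2 ≤ 2 * k * l ^ 2 := by gcongr
        have e2 : k * l ^ 2 = l * δ := by rw [← hlk]; ring
        nlinarith

lemma tail_dn {n : ℕ} (A : Finset (Fin n)) (k δ τ w0 : ℝ) (hk : 0 < k) (hδ : 0 ≤ δ) (hδk : δ ≤ k)
    (hw0 : 0 ≤ w0) (hA : w0 ≤ A.card) (hw : w0 ≤ 2 * k) (hτ : τ ≤ w0 / 4 - δ) :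
    (∑ ω : Fin n → Fin 4, if ((A.filter fun i => ω i = 0).card : ℝ) ≤ τ
      then (1:ℝ) else 0) ≤ Real.exp (-(δ ^ 2 / (2 * k))) * 4 ^ n := by
  set l := δ / k with hl
  have hl0 : 0 ≤ l := by positivity
  have hl1 : l ≤ 1 := by rw [hl, div_le_one hk]; exact hδk
  have hlk : l * k = δ := by rw [hl]; field_simp
  set w : ℝ := (A.card : ℝ)
  have step : ∀ ω : Fin n → Fin 4, (if ((A.filter fun i => ω i = 0).card : ℝ) ≤ τ
      then (1:ℝ) else 0) ≤ Real.exp (l * τ) *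
        (Real.exp (-l)) ^ (A.filter fun i => ω i = 0).card := by
    intro ω
    split_ifs with h
    · rw [← Real.exp_nat_mul, ← Real.exp_add]
      apply Real.one_le_exp
      nlinarith
    · positivity
  refine (Finset.sum_le_sum fun ω _ => step ω).trans ?_
  rw [← Finset.mul_sum]
  have := mgf 3 A (Real.exp (-l))
  norm_num at this
  rw [this, ← mul_assoc]
  gcongr
  have h1 : Real.exp (-l) ≤ 1 - l + l ^ 2 := by
    have := (abs_le.1 (Real.abs_exp_sub_one_sub_id_le (x := -l)
      (by rw [abs_neg, abs_of_nonneg hl0]; exact hl1))).2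
    linarith [neg_sq l]
  have h0 : 0 < Real.exp (-l) := Real.exp_pos _
  have h2 : 1 + (Real.exp (-l) - 1) / 4 ≤ Real.exp ((-l + l ^ 2) / 4) := by
    have := Real.add_one_le_exp ((-l + l ^ 2) / 4)
    linarith
  calc Real.exp (l * τ) * (1 + (Real.exp (-l) - 1) / 4) ^ A.card
      ≤ Real.exp (l * τ) * (Real.exp ((-l + l ^ 2) / 4)) ^ A.card := by
        gcongr
        linarith
    _ = Real.exp (l * τ + w * ((-l + l ^ 2) / 4)) := by
        rw [← Real.exp_nat_mul, ← Real.exp_add]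
    _ ≤ _ := by
        apply Real.exp_le_exp.2
        have e : δ ^ 2 / (2 * k) = l * δ / 2 := by rw [hl]; field_simp
        rw [e]
        have hll : 0 ≤ l - l ^ 2 := by nlinarith
        have a1 : w0 * (l - l ^ 2) ≤ w * (l - l ^ 2) := by gcongr
        have a2 : l * τ ≤ l * (w0 / 4 - δ) := by gcongr
        have : w0 * l ^ 2 ≤ 2 * k * l ^ 2 := by gcongr
        have e2 : k * l ^ 2 = l * δ := by rw [← hlk]; ring
        nlinarith

/-- `u` and `w` agree, or both are at least `k`. -/
def Approx (k u w : ℕ) : Prop := u = w ∨ (k ≤ u ∧ k ≤ w)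

open Classical in
/-- a random estimator of the weight, correct up to truncation at `k`, of degree at most `d`
and error at most `2^{-m}` -/
def PP (F : Type) [Field F] (n k m d : ℕ) : Prop :=
  ∃ (Ω : Type) (_ : Fintype Ω) (_ : Nonempty Ω)
    (V : Ω → Bool → Finset (Fin n) → (Fin n → Bool) → ℕ),
    (∀ ω b S, DegLE F (V ω b S) d) ∧
    ∀ b S a, (∑ ω, if Approx k (V ω b S a) (cnt b S a) then (0:ℝ) else 1)
      ≤ (1 / 2) ^ m * Fintype.card Ω

lemma Approx.mono {k k' u w : ℕ} (h : Approx k u w) (hk : k' ≤ k) : Approx k' u w := by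
  unfold Approx at *
  omega

lemma PP.mono {F : Type} [Field F] {n k k' m d d' : ℕ} (h : PP F n k m d) (hk : k' ≤ k)
    (hd : d ≤ d') : PP F n k' m d' := by
  classical
  obtain ⟨Ω, i1, i2, V, h1, h2⟩ := h
  refine ⟨Ω, i1, i2, V, fun ω b S => (h1 ω b S).mono hd, fun b S a => ?_⟩
  refine le_trans (Finset.sum_le_sum fun ω _ => ?_) (h2 b S a)
  by_cases h : Approx k (V ω b S a) (cnt b S a)
  · simp [h, h.mono hk]
  · rw [if_neg h]
    split_ifs <;> norm_num

/-- the representative of `r` mod `M` in the window of length `M` around `4u` -/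
def win (M r u : ℕ) : ℕ :=
  (4 * u - M / 2) + (r + (M - (4 * u - M / 2) % M)) % M

lemma win_ge (M r u : ℕ) : 4 * u - M / 2 ≤ win M r u := Nat.le_add_right _ _

lemma win_eq (M w u : ℕ) (hM : 0 < M) (h1 : 4 * u - M / 2 ≤ w) (h2 : w < 4 * u - M / 2 + M) :
    win M (w % M) u = w := by
  unfold win
  generalize 4 * u - M / 2 = lo at *
  obtain ⟨e, rfl⟩ := Nat.exists_eq_add_of_le h1
  have he : e < M := by omega
  have hl : lo % M < M := Nat.mod_lt _ hM
  congr 1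
  have : ((lo + e) % M + (M - lo % M)) % M = e % M := by
    have h3 : (lo + e) % M + (M - lo % M) ≡ (lo + e) + (M - lo % M) [MOD M] :=
      Nat.ModEq.add_right _ (Nat.mod_modEq _ _)
    have h4 : (lo + e) + (M - lo % M) = e + M * (lo / M + 1) := by
      have := Nat.mod_add_div lo M
      rw [mul_add]
      omega
    rw [h4] at h3
    have h5 : e + M * (lo / M + 1) ≡ e [MOD M] := by
      unfold Nat.ModEq
      simp
    exact h3.trans h5
  rw [this, Nat.mod_eq_of_lt he]

/-- the sampling event -/
def Good (k M w v : ℕ) : Prop :=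
  (w ≤ 2 * k → 4 * v ≤ w + M / 2 ∧ w + M / 2 < 4 * v + M) ∧ (2 * k < w → k + M / 2 ≤ 4 * v)

lemma good_win {k M w v u : ℕ} (hM : 0 < M) (hMk : M ≤ k) (hk : 4 ≤ k) (hg : Good k M w v)
    (hu : Approx (k / 2) u v) : Approx k (win M (w % M) u) w := by
  unfold Good at hg
  obtain ⟨g1, g2⟩ := hg
  have hge := win_ge M (w % M) u
  rcases hu with rfl | ⟨hu1, hv1⟩
  · rcases le_or_gt w (2 * k) with h | h
    · left
      apply win_eq _ _ _ hM <;> have := g1 h <;> omega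
    · right
      have := g2 h
      omega
  · right
    constructor
    · omega
    · rcases le_or_gt w (2 * k) with h | h
      · have := g1 h
        omega
      · omega

open Classical in
lemma samp {n : ℕ} (A : Finset (Fin n)) (k M m : ℕ) (hk : 4 ≤ k) (hm : 2 ≤ m) (hMk : M ≤ k)
    (hM : 256 * k * m ≤ M ^ 2) :
    (∑ τ : Fin n → Fin 4, if Good k M A.card (A.filter fun i => τ i = 0).card then (0:ℝ) else 1)
      ≤ (1 / 2) ^ (m + 1) * 4 ^ n := by
  have hkR : (0:ℝ) < k := by positivity
  have hMkR : (M:ℝ) ≤ k := by exact_mod_cast hMk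
  have hMR : 256 * (k:ℝ) * m ≤ (M:ℝ) ^ 2 := by exact_mod_cast hM
  have hmR : (2:ℝ) ≤ m := by exact_mod_cast hm
  set δ : ℝ := (M:ℝ) / 8 with hδ
  have hδ0 : 0 ≤ δ := by positivity
  have hδk : δ ≤ k := by rw [hδ]; linarith
  have hexp : Real.exp (-(δ ^ 2 / (2 * k))) ≤ (1 / 2) ^ (m + 2) := by
    have h1 : ((m + 2 : ℕ) : ℝ) ≤ δ ^ 2 / (2 * k) := by
      rw [le_div_iff₀ (by positivity), hδ]
      push_cast
      nlinarith
    have h2 : Real.exp (-1) ≤ 1 / 2 := by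
      rw [Real.exp_neg, one_div]
      apply inv_anti₀ (by norm_num)
      linarith [Real.add_one_le_exp (1:ℝ)]
    calc Real.exp (-(δ ^ 2 / (2 * k))) ≤ Real.exp (((m + 2 : ℕ) : ℝ) * (-1)) := by
          apply Real.exp_le_exp.2; linarith
      _ = Real.exp (-1) ^ (m + 2) := by rw [Real.exp_nat_mul]
      _ ≤ _ := by gcongr
  have hhalf : ((M / 2 : ℕ) : ℝ) ≤ M / 2 ∧ (M : ℝ) / 2 ≤ ((M / 2 : ℕ) : ℝ) + 1 / 2 := by
    have h1 : 2 * (M / 2) ≤ M := by omega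
    have h2 : M ≤ 2 * (M / 2) + 1 := by omega
    have h1R : 2 * ((M / 2 : ℕ) : ℝ) ≤ M := by exact_mod_cast h1
    have h2R : (M : ℝ) ≤ 2 * ((M / 2 : ℕ) : ℝ) + 1 := by exact_mod_cast h2
    constructor <;> linarith
  obtain ⟨hh1, hh2⟩ := hhalf
  have h4 : (0:ℝ) ≤ 4 ^ n := by positivity
  have hp2 : (1 / 2 : ℝ) ^ (m + 1) = 2 * (1 / 2) ^ (m + 2) := by ring
  rcases le_or_gt A.card (2 * k) with hw | hw
  · have hwR : (A.card : ℝ) ≤ 2 * k := by exact_mod_cast hw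
    have up := tail_up A k δ hkR hδ0 hδk hwR
    have dn := tail_dn A k δ (A.card / 4 - δ) A.card hkR hδ0 hδk (by positivity) le_rfl hwR le_rfl
    have hsum : (∑ τ : Fin n → Fin 4,
        if Good k M A.card (A.filter fun i => τ i = 0).card then (0:ℝ) else 1)
        ≤ (∑ ω : Fin n → Fin 4, if (A.card : ℝ) / 4 + δ ≤ ((A.filter fun i => ω i = 0).card : ℝ)
      then (1:ℝ) else 0) + (∑ ω : Fin n → Fin 4, if ((A.filter fun i => ω i = 0).card : ℝ) ≤
        A.card / 4 - δ then (1:ℝ) else 0) := by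
      rw [← Finset.sum_add_distrib]
      refine Finset.sum_le_sum fun τ _ => ?_
      generalize (A.filter fun i => τ i = 0).card = v
      by_cases hg : Good k M A.card v
      · rw [if_pos hg]
        split_ifs <;> norm_num
      · rw [if_neg hg]
        have hor : A.card + M / 2 + 1 ≤ 4 * v ∨ 4 * v + M ≤ A.card + M / 2 := by
          unfold Good at hg
          omega
        rcases hor with h | h
        · have hR : (A.card : ℝ) + ((M / 2 : ℕ) : ℝ) + 1 ≤ 4 * v := by exact_mod_cast h
          rw [if_pos (by linarith)]
          split_ifs <;> norm_num
        · have hR : 4 * (v : ℝ) + M ≤ A.card + ((M / 2 : ℕ) : ℝ) := by exact_mod_cast h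
          rw [if_pos (show (v:ℝ) ≤ A.card / 4 - δ by linarith)]
          split_ifs <;> norm_num
    rw [hp2]
    nlinarith
  · have hwR : 2 * (k:ℝ) ≤ (A.card : ℝ) := by exact_mod_cast hw.le
    have dn := tail_dn A k δ (k / 4 + δ) (2 * k) hkR hδ0 hδk (by positivity) hwR le_rfl (by linarith)
    have hsum : (∑ τ : Fin n → Fin 4,
        if Good k M A.card (A.filter fun i => τ i = 0).card then (0:ℝ) else 1)
        ≤ (∑ ω : Fin n → Fin 4, if ((A.filter fun i => ω i = 0).card : ℝ) ≤
        k / 4 + δ then (1:ℝ) else 0) := by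
      refine Finset.sum_le_sum fun τ _ => ?_
      generalize (A.filter fun i => τ i = 0).card = v
      by_cases hg : Good k M A.card v
      · rw [if_pos hg]
        split_ifs <;> norm_num
      · rw [if_neg hg]
        have h : 4 * v ≤ k + M / 2 := by
          unfold Good at hg
          omega
        have hR : 4 * (v : ℝ) ≤ k + ((M / 2 : ℕ) : ℝ) := by exact_mod_cast h
        rw [if_pos (by linarith)]
    rw [hp2]
    have : (0:ℝ) ≤ (1 / 2) ^ (m + 2) := by positivity
    nlinarith

lemma PP.step {F : Type} [Field F] {p : ℕ} [CharP F p] (hp : p.Prime) {n k m t d : ℕ}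
    (hk : 4 ≤ k) (hm : 2 ≤ m) (hMk : p ^ t ≤ k) (hM : 256 * k * m ≤ (p ^ t) ^ 2)
    (h : PP F n (k / 2) (m + 1) d) : PP F n k m (d + p ^ t) := by
  classical
  obtain ⟨Ω, i1, i2, V, h1, h2⟩ := h
  set M := p ^ t with hMdef
  have hM0 : 0 < M := pow_pos hp.pos t
  refine ⟨(Fin n → Fin 4) × Ω, inferInstance, inferInstance, fun τω b S a =>
    win M (cnt b S a % M) (V τω.2 b (S.filter fun i => τω.1 i = 0) a), ?_, ?_⟩
  · rintro ⟨τ, ω⟩ b S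
    exact ((h1 ω b (S.filter fun i => τ i = 0)).prod (degLE_cnt F p hp t b S)).comp
      (fun x => win M x.2 x.1)
  · intro b S a
    rw [Fintype.sum_prod_type]
    simp only
    set A := S.filter fun i => a i = b with hA
    have hcnt : cnt b S a = A.card := rfl
    have hcnt' : ∀ τ : Fin n → Fin 4, cnt b (S.filter fun i => τ i = 0) a
        = (A.filter fun i => τ i = 0).card := by
      intro τ
      unfold cnt
      rw [hA, Finset.filter_filter, Finset.filter_filter]
      simp only [and_comm]
    have key : ∀ τ : Fin n → Fin 4, (∑ ω, if Approx k (win M (cnt b S a % M)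
        (V ω b (S.filter fun i => τ i = 0) a)) (cnt b S a) then (0:ℝ) else 1)
        ≤ (if Good k M A.card (A.filter fun i => τ i = 0).card then (0:ℝ) else 1) * Fintype.card Ω
          + (1 / 2) ^ (m + 1) * Fintype.card Ω := by
      intro τ
      refine le_trans ?_ (add_le_add_right (h2 b (S.filter fun i => τ i = 0) a) _)
      have : (if Good k M A.card (A.filter fun i => τ i = 0).card then (0:ℝ) else 1)
          * Fintype.card Ω
          = ∑ ω : Ω, (if Good k M A.card (A.filter fun i => τ i = 0).card then (0:ℝ) else 1) := by
        rw [Finset.sum_const, nsmul_eq_mul, mul_comm]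
        rfl
      rw [this, ← Finset.sum_add_distrib]
      refine Finset.sum_le_sum fun ω _ => ?_
      by_cases hg : Good k M A.card (A.filter fun i => τ i = 0).card
      · by_cases ha : Approx (k / 2) (V ω b (S.filter fun i => τ i = 0) a)
          (cnt b (S.filter fun i => τ i = 0) a)
        · rw [hcnt, if_pos (good_win hM0 hMk hk hg (hcnt' τ ▸ ha)), if_pos hg, if_pos ha]
          norm_num
        · rw [if_pos hg, if_neg ha]
          split_ifs <;> norm_num
      · rw [if_neg hg]
        split_ifs <;> norm_num
    refine (Finset.sum_le_sum fun τ _ => key τ).trans ?_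
    rw [Finset.sum_add_distrib, ← Finset.sum_mul, Finset.sum_const, nsmul_eq_mul]
    have hs := samp A k M m hk hm hMk hM
    have hc : ((Finset.univ : Finset (Fin n → Fin 4)).card : ℝ) = 4 ^ n := by
      simp
    rw [hc, Fintype.card_prod]
    push_cast
    have hc' : ((Fintype.card (Fin n → Fin 4) : ℕ) : ℝ) = 4 ^ n := by simp
    rw [hc']
    have hcΩ : (0:ℝ) ≤ Fintype.card Ω := by positivity
    have := mul_le_mul_of_nonneg_right hs hcΩ
    have e : (1 / 2 : ℝ) ^ m = 2 * (1 / 2) ^ (m + 1) := by ring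
    rw [e]
    nlinarith

lemma half_mod {n : ℕ} (p : ℕ) (hp : 2 ≤ p) (A : Finset (Fin n)) (hA : A.Nonempty) :
    (∑ U : Finset (Fin n), if (A.filter fun i => i ∈ U).card % p = 0 then (1:ℝ) else 0)
      ≤ 1 / 2 * 2 ^ n := by
  classical
  obtain ⟨i0, hi0⟩ := hA
  set φ : Finset (Fin n) → Finset (Fin n) := fun U => symmDiff U {i0} with hφ
  have hinv : Function.Involutive φ := by
    intro U
    simp [hφ]
  set g : Finset (Fin n) → ℝ := fun U => if (A.filter fun i => i ∈ U).card % p = 0 then (1:ℝ) else 0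
    with hg
  have hsum : ∑ U, g (φ U) = ∑ U, g U := Equiv.sum_comp hinv.toPerm g
  have aux : ∀ U, i0 ∉ U → (A.filter fun i => i ∈ φ U).card = (A.filter fun i => i ∈ U).card + 1 := by
    intro U hU
    have : (A.filter fun i => i ∈ φ U) = insert i0 (A.filter fun i => i ∈ U) := by
      ext i
      simp only [hφ, Finset.mem_filter, Finset.mem_symmDiff, Finset.mem_singleton,
        Finset.mem_insert]
      grind
    rw [this, Finset.card_insert_of_notMem (by simp [hU])]
  have nb : ∀ c : ℕ, ¬ (c % p = 0 ∧ (c + 1) % p = 0) := by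
    rintro c ⟨h1, h2⟩
    have h1' := Nat.dvd_of_mod_eq_zero h1
    have h2' := Nat.dvd_of_mod_eq_zero h2
    have := (Nat.dvd_add_right h1').1 h2'
    have := Nat.le_of_dvd one_pos this
    omega
  have le0 : ∀ U, i0 ∉ U → g U + g (φ U) ≤ 1 := by
    intro U hU
    simp only [hg, aux U hU]
    have := nb (A.filter fun i => i ∈ U).card
    split_ifs <;> first | (exfalso; tauto) | norm_num
  have le1 : ∀ U, g U + g (φ U) ≤ 1 := by
    intro U
    by_cases hU : i0 ∈ U
    · have h := le0 (φ U) (by simp [hφ, Finset.mem_symmDiff, hU])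
      rw [hinv U] at h
      linarith
    · exact le0 U hU
  have : ∑ U, (g U + g (φ U)) ≤ ∑ _U : Finset (Fin n), (1:ℝ) := Finset.sum_le_sum fun U _ => le1 U
  rw [Finset.sum_add_distrib, hsum] at this
  simp at this
  linarith

/-- the indicator that a random sub-sample has nonzero sum mod `p` -/
def zz {n N : ℕ} (p : ℕ) (A : Finset (Fin n)) (x : (Fin n → Fin (N + 1)) × Finset (Fin n)) : ℕ :=
  if (A.filter fun i => x.1 i = 0 ∧ i ∈ x.2).card % p = 0 then 0 else 1

lemma zz_low {n N : ℕ} (p : ℕ) (A : Finset (Fin n)) (l : ℝ) (hl : 1 ≤ l) (K : ℕ) (hK : 0 < K)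
    (hN : (N : ℝ) + 1 = l * K) (hA : A.card ≤ K) :
    ∑ x : (Fin n → Fin (N + 1)) × Finset (Fin n), l ^ (zz p A x)
      ≤ 3 * Fintype.card ((Fin n → Fin (N + 1)) × Finset (Fin n)) := by
  classical
  have h1 : ∀ x : (Fin n → Fin (N + 1)) × Finset (Fin n),
      l ^ (zz p A x) ≤ l ^ (A.filter fun i => x.1 i = 0).card := by
    intro x
    apply pow_le_pow_right₀ hl
    have hle : (A.filter fun i => x.1 i = 0 ∧ i ∈ x.2).card ≤ (A.filter fun i => x.1 i = 0).card := by
      apply Finset.card_le_card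
      intro i
      simp only [Finset.mem_filter]
      tauto
    refine le_trans ?_ hle
    unfold zz
    split_ifs with h
    · exact Nat.zero_le _
    · apply Nat.one_le_iff_ne_zero.2
      intro h0
      rw [h0] at h
      simp at h
  refine (Finset.sum_le_sum fun x _ => h1 x).trans ?_
  rw [Fintype.sum_prod_type]
  simp only [Finset.sum_const, nsmul_eq_mul]
  rw [← Finset.mul_sum, mgf]
  have hK' : (0:ℝ) < K := by exact_mod_cast hK
  have hb : (1 + (l - 1) / ((N:ℝ) + 1)) ^ A.card ≤ 3 := by
    have e1 : (l - 1) / ((N:ℝ) + 1) ≤ 1 / K := by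
      rw [hN, div_le_div_iff₀ (by positivity) hK']
      nlinarith
    have e0 : 0 ≤ (l - 1) / ((N:ℝ) + 1) := div_nonneg (by linarith) (by positivity)
    calc (1 + (l - 1) / ((N:ℝ) + 1)) ^ A.card ≤ (1 + (l - 1) / ((N:ℝ) + 1)) ^ K :=
          pow_le_pow_right₀ (by linarith) hA
      _ ≤ (Real.exp (1 / K)) ^ K := by
          gcongr
          linarith [Real.add_one_le_exp (1 / (K:ℝ))]
      _ = Real.exp 1 := by
          rw [← Real.exp_nat_mul]
          congr 1
          field_simp
      _ ≤ 3 := by linarith [Real.exp_one_lt_d9]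
  have hcard : (Fintype.card ((Fin n → Fin (N + 1)) × Finset (Fin n)) : ℝ)
      = ((N:ℝ) + 1) ^ n * 2 ^ n := by
    simp
  have hu : ((Finset.univ : Finset (Finset (Fin n))).card : ℝ) = 2 ^ n := by simp
  rw [hcard, hu]
  have : (0:ℝ) ≤ ((N:ℝ) + 1) ^ n * 2 ^ n := by positivity
  nlinarith

lemma zz_high {n N : ℕ} (p : ℕ) (hp : 2 ≤ p) (A : Finset (Fin n))
    (hA : 2 * (N + 1) ≤ A.card) :
    ∑ x : (Fin n → Fin (N + 1)) × Finset (Fin n), (1 / 2 : ℝ) ^ (zz p A x)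
      ≤ 7 / 8 * Fintype.card ((Fin n → Fin (N + 1)) × Finset (Fin n)) := by
  classical
  have hcard : (Fintype.card ((Fin n → Fin (N + 1)) × Finset (Fin n)) : ℝ)
      = ((N:ℝ) + 1) ^ n * 2 ^ n := by
    simp
  rw [hcard, Fintype.sum_prod_type]
  have key : ∀ T : Fin n → Fin (N + 1), (∑ U : Finset (Fin n), (1 / 2 : ℝ) ^ (zz p A (T, U)))
      ≤ (3 / 4 + 1 / 4 * 0 ^ (A.filter fun i => T i = 0).card) * 2 ^ n := by
    intro T
    have hz : ∀ U, (1 / 2 : ℝ) ^ (zz p A (T, U)) = 1 / 2 + 1 / 2 *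
        (if ((A.filter fun i => T i = 0).filter fun i => i ∈ U).card % p = 0 then (1:ℝ) else 0) := by
      intro U
      rw [Finset.filter_filter]
      unfold zz
      simp only
      split_ifs <;> norm_num
    simp only [hz]
    rw [Finset.sum_add_distrib, ← Finset.mul_sum]
    simp only [Finset.sum_const, nsmul_eq_mul]
    have hu : ((Finset.univ : Finset (Finset (Fin n))).card : ℝ) = 2 ^ n := by simp
    rw [hu]
    by_cases hne : (A.filter fun i => T i = 0).Nonempty
    · have := half_mod p hp _ hne
      rw [zero_pow (Finset.card_pos.2 hne).ne']
      linarith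
    · rw [Finset.not_nonempty_iff_eq_empty] at hne
      rw [hne]
      simp
      apply le_of_eq
      ring
  refine (Finset.sum_le_sum fun T _ => key T).trans ?_
  rw [← Finset.sum_mul, Finset.sum_add_distrib, ← Finset.mul_sum, mgf]
  simp only [Finset.sum_const, nsmul_eq_mul]
  have hu : ((Finset.univ : Finset (Fin n → Fin (N+1))).card : ℝ) = ((N:ℝ) + 1) ^ n := by simp
  rw [hu]
  have hN : (0:ℝ) < (N:ℝ) + 1 := by positivity
  have hb : (1 + ((0:ℝ) - 1) / ((N:ℝ) + 1)) ^ A.card ≤ 1 / 2 := by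
    have e0 : 0 ≤ 1 + ((0:ℝ) - 1) / ((N:ℝ) + 1) := by
      rw [show 1 + ((0:ℝ) - 1) / ((N:ℝ) + 1) = N / ((N:ℝ) + 1) by field_simp; ring]
      positivity
    have e1 : 1 + ((0:ℝ) - 1) / ((N:ℝ) + 1) ≤ 1 := by
      have : ((0:ℝ) - 1) / ((N:ℝ) + 1) ≤ 0 := div_nonpos_of_nonpos_of_nonneg (by norm_num) hN.le
      linarith
    calc (1 + ((0:ℝ) - 1) / ((N:ℝ) + 1)) ^ A.card
        ≤ (1 + ((0:ℝ) - 1) / ((N:ℝ) + 1)) ^ (N + 1) :=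
          pow_le_pow_of_le_one e0 e1 (by omega)
      _ ≤ (Real.exp (((0:ℝ) - 1) / ((N:ℝ) + 1))) ^ (N + 1) := by
          gcongr
          linarith [Real.add_one_le_exp (((0:ℝ) - 1) / ((N:ℝ) + 1))]
      _ = Real.exp (-1) := by
          rw [← Real.exp_nat_mul]
          congr 1
          push_cast
          field_simp
          ring
      _ ≤ 1 / 2 := by
          rw [Real.exp_neg, one_div]
          apply inv_anti₀ (by norm_num)
          linarith [Real.add_one_le_exp (1:ℝ)]
  have h3 : (0:ℝ) ≤ ((N:ℝ) + 1) ^ n * 2 ^ n := by positivity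
  nlinarith

lemma sum_pow_count {Ω : Type} [Fintype Ω] (L : ℕ) (z : Ω → ℕ) (c : ℝ) :
    ∑ ω : Fin L → Ω, c ^ (∑ j, z (ω j)) = (∑ x, c ^ z x) ^ L := by
  classical
  rw [Fintype.sum_pow]
  refine Finset.sum_congr rfl fun ω _ => ?_
  rw [Finset.prod_pow_eq_pow_sum]

lemma PP.base {F : Type} [Field F] {p : ℕ} [CharP F p] (hp : p.Prime) {n K m t : ℕ}
    (hK : 0 < K) (hM : 2 * (2 ^ 27 * K) ≤ p ^ t) : PP F n K m (p ^ t + 16 * m * p) := by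
  classical
  obtain ⟨N, hN⟩ : ∃ N, N + 1 = 2 ^ 27 * K := ⟨2 ^ 27 * K - 1, by omega⟩
  have hNR : (N : ℝ) + 1 = (2 ^ 27 : ℝ) * K := by exact_mod_cast hN
  rw [← hN] at hM
  set M := p ^ t with hMdef
  set L := 16 * m with hL
  set Ω1 := (Fin n → Fin (N + 1)) × Finset (Fin n) with hΩ1
  refine ⟨Fin L → Ω1, inferInstance, inferInstance, fun ω b S a =>
    if (∑ j, zz p (S.filter fun i => a i = b) (ω j)) < m then cnt b S a % M else K, ?_, ?_⟩
  · intro ω b S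
    have h1 := DegLE.pi (F := F) L (fun j a =>
      cnt b (S.filter fun i => (ω j).1 i = 0 ∧ i ∈ (ω j).2) a % p ^ 1)
      (fun j => degLE_cnt F p hp 1 b _)
    have h2 := ((degLE_cnt F p hp t b S).prod h1).comp
      (fun x => if (∑ j, if x.2 j = 0 then 0 else 1) < m then x.1 else K)
    rw [pow_one] at h2
    convert h2 using 1
    funext a
    have : ∀ j, zz p (S.filter fun i => a i = b) (ω j) =
        if cnt b (S.filter fun i => (ω j).1 i = 0 ∧ i ∈ (ω j).2) a % p = 0 then 0 else 1 := by
      intro j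
      unfold zz cnt
      rw [Finset.filter_filter, Finset.filter_filter]
      simp only [and_comm]
    simp only [this, hMdef]
  · intro b S a
    set A := S.filter fun i => a i = b with hA
    have hcnt : cnt b S a = A.card := rfl
    rw [hcnt]
    have hcΩ : (Fintype.card (Fin L → Ω1) : ℝ) = (Fintype.card Ω1 : ℝ) ^ L := by simp
    rw [hcΩ]
    have hM0 : 0 < M := pow_pos hp.pos t
    have hc0 : (0:ℝ) ≤ Fintype.card Ω1 := by positivity
    have hKM : K ≤ M := by
      have : 1 * K ≤ 2 ^ 27 * K := Nat.mul_le_mul_right _ (by norm_num)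
      omega
    rcases lt_or_ge A.card K with hw | hw
    · have hb : ∀ ω : Fin L → Ω1, (if Approx K (if (∑ j, zz p A (ω j)) < m then A.card % M else K)
          A.card then (0:ℝ) else 1) ≤ (1 / 2 ^ 27) ^ m * (2 ^ 27) ^ (∑ j, zz p A (ω j)) := by
        intro ω
        by_cases hz : (∑ j, zz p A (ω j)) < m
        · rw [if_pos hz, Nat.mod_eq_of_lt (hw.trans_le hKM), if_pos (show Approx K A.card A.card from Or.inl rfl)]
          positivity
        · have : (1:ℝ) ≤ (1 / 2 ^ 27) ^ m * (2 ^ 27) ^ (∑ j, zz p A (ω j)) := by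
            calc (1:ℝ) = (1 / 2 ^ 27) ^ m * (2 ^ 27) ^ m := by
                  rw [← mul_pow]; norm_num
              _ ≤ _ := by
                  gcongr
                  · norm_num
                  · omega
          refine le_trans ?_ this
          split_ifs <;> norm_num
      refine (Finset.sum_le_sum fun ω _ => hb ω).trans ?_
      rw [← Finset.mul_sum, sum_pow_count]
      have hlow := zz_low (N := N) p A (2 ^ 27) (by norm_num) K hK hNR hw.le
      calc (1 / 2 ^ 27 : ℝ) ^ m * (∑ x : Ω1, (2 ^ 27 : ℝ) ^ zz p A x) ^ L
          ≤ (1 / 2 ^ 27 : ℝ) ^ m * (3 * Fintype.card Ω1) ^ L := by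
            gcongr
        _ = ((1 / 2 ^ 27) * 3 ^ 16) ^ m * (Fintype.card Ω1 : ℝ) ^ L := by
            rw [mul_pow, mul_pow, hL, pow_mul (3:ℝ)]
            ring
        _ ≤ _ := by
            gcongr
            norm_num
    rcases lt_or_ge A.card M with hw2 | hw2
    · have hb : ∀ ω : Fin L → Ω1, (if Approx K (if (∑ j, zz p A (ω j)) < m then A.card % M else K)
          A.card then (0:ℝ) else 1) = 0 := by
        intro ω
        rw [if_pos]
        rw [Nat.mod_eq_of_lt hw2]
        unfold Approx
        split_ifs <;> omega
      refine (Finset.sum_le_sum fun ω _ => (hb ω).le).trans ?_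
      rw [Finset.sum_const_zero]
      positivity
    · have hb : ∀ ω : Fin L → Ω1, (if Approx K (if (∑ j, zz p A (ω j)) < m then A.card % M else K)
          A.card then (0:ℝ) else 1) ≤ 2 ^ m * (1 / 2) ^ (∑ j, zz p A (ω j)) := by
        intro ω
        by_cases hz : (∑ j, zz p A (ω j)) < m
        · have : (1:ℝ) ≤ 2 ^ m * (1 / 2) ^ (∑ j, zz p A (ω j)) := by
            calc (1:ℝ) = 2 ^ m * (1 / 2) ^ m := by
                  rw [← mul_pow]; norm_num
              _ ≤ _ := by
                  gcongr ?_ * ?_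
                  exact pow_le_pow_of_le_one (by norm_num) (by norm_num) hz.le
          refine le_trans ?_ this
          split_ifs <;> norm_num
        · rw [if_neg hz, if_pos (show Approx K K A.card from Or.inr ⟨le_rfl, hw⟩)]
          positivity
      refine (Finset.sum_le_sum fun ω _ => hb ω).trans ?_
      rw [← Finset.mul_sum, sum_pow_count]
      have hhigh := zz_high (N := N) p hp.two_le A (hM.trans hw2)
      calc (2 : ℝ) ^ m * (∑ x : Ω1, (1 / 2 : ℝ) ^ zz p A x) ^ L
          ≤ (2 : ℝ) ^ m * (7 / 8 * Fintype.card Ω1) ^ L := by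
            gcongr
        _ = (2 * (7 / 8) ^ 16) ^ m * (Fintype.card Ω1 : ℝ) ^ L := by
            rw [mul_pow, mul_pow, hL, pow_mul (7 / 8 : ℝ)]
            ring
        _ ≤ _ := by
            gcongr
            norm_num

lemma exists_pow_between {p : ℕ} (hp : p.Prime) (x : ℕ) (hx : 0 < x) :
    ∃ t, x ≤ p ^ t ∧ p ^ t ≤ p * x := by
  refine ⟨Nat.log p x + 1, (Nat.lt_pow_succ_log_self hp.one_lt x).le, ?_⟩
  rw [pow_succ, mul_comm]
  exact Nat.mul_le_mul_left _ (Nat.pow_log_le_self p hx.ne')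

lemma PP.main {p : ℕ} (hp : p.Prime) (F : Type) [Field F] [CharP F p] (n : ℕ) (A B : ℝ)
    (hB : B = 2 ^ 38 * (p:ℝ) ^ 3 + 16 * p) (hA : A = 8 * (B + 32 * p)) :
    ∀ k m : ℕ, 2 ≤ m → ∃ d : ℕ, PP F n k m d ∧ (d : ℝ) ≤ A * Real.sqrt (k * m) + B * m := by
  intro k
  induction k using Nat.strong_induction_on with
  | _ k ih =>
  intro m hm
  have hp1 : (1:ℝ) ≤ p := by exact_mod_cast hp.one_lt.le
  have hmR : (2:ℝ) ≤ m := by exact_mod_cast hm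
  have hB0 : 0 ≤ B := by rw [hB]; positivity
  have hA0 : 0 ≤ A := by rw [hA]; positivity
  rcases lt_or_ge k (1024 * p ^ 2 * m) with hk | hk
  · have hK : 0 < 1024 * p ^ 2 * m := by omega
    obtain ⟨t, ht1, ht2⟩ := exists_pow_between hp (2 * (2 ^ 27 * (1024 * p ^ 2 * m))) (by omega)
    refine ⟨_, (PP.base (F := F) (n := n) (m := m) hp hK ht1).mono hk.le le_rfl, ?_⟩
    have ht2R : ((p ^ t : ℕ) : ℝ) ≤ p * (2 * (2 ^ 27 * (1024 * (p:ℝ) ^ 2 * m))) := by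
      exact_mod_cast ht2
    have : 0 ≤ A * Real.sqrt (k * m) := by positivity
    rw [Nat.cast_add, hB]
    push_cast at ht2R ⊢
    nlinarith
  · set s := Real.sqrt ((k:ℝ) * m) with hs
    have hkR : 1024 * (p:ℝ) ^ 2 * m ≤ k := by exact_mod_cast hk
    have hs2 : s ^ 2 = k * m := Real.sq_sqrt (by positivity)
    have hs0 : 0 ≤ s := Real.sqrt_nonneg _
    have hp2 : (1:ℝ) ≤ (p:ℝ) ^ 2 := one_le_pow₀ hp1
    have hk1 : (1024:ℝ) ≤ k := by nlinarith
    have hk4 : 1024 ≤ k := by exact_mod_cast hk1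
    have hs1 : 1 ≤ s := by
      rw [hs]
      apply Real.le_sqrt_of_sq_le
      nlinarith
    have hsk : 32 * p * s ≤ k := by
      apply abs_le_of_sq_le_sq' _ (by positivity) |>.2
      have : (32 * p * s) ^ 2 = (1024 * (p:ℝ) ^ 2 * m) * k := by
        rw [mul_pow, hs2]; ring
      rw [this]
      nlinarith
    obtain ⟨t, ht1, ht2⟩ := exists_pow_between hp (Nat.sqrt (256 * k * m) + 1) (by omega)
    have hM : 256 * k * m ≤ (p ^ t) ^ 2 := by
      have h1 := (Nat.lt_succ_sqrt (256 * k * m)).le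
      calc 256 * k * m ≤ (Nat.sqrt (256 * k * m) + 1) ^ 2 := by rw [sq]; exact h1
        _ ≤ _ := by gcongr
    have hsq : (Nat.sqrt (256 * k * m) : ℝ) ≤ 16 * s := by
      apply abs_le_of_sq_le_sq' _ (by positivity) |>.2
      rw [mul_pow, hs2]
      have h1 := Nat.sqrt_le' (256 * k * m)
      have h1R : ((Nat.sqrt (256 * k * m) : ℕ) : ℝ) ^ 2 ≤ 256 * k * m := by exact_mod_cast h1
      linarith
    have hMR : ((p ^ t : ℕ) : ℝ) ≤ 32 * p * s := by
      have ht2R : ((p ^ t : ℕ) : ℝ) ≤ p * ((Nat.sqrt (256 * k * m) : ℝ) + 1) := by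
        exact_mod_cast ht2
      have : p * ((Nat.sqrt (256 * k * m) : ℝ) + 1) ≤ p * (32 * s) := by
        gcongr
        linarith
      linarith
    have hMk : p ^ t ≤ k := by exact_mod_cast hMR.trans hsk
    obtain ⟨d, hd1, hd2⟩ := ih (k / 2) (by omega) (m + 1) (by omega)
    refine ⟨_, PP.step hp (by omega) hm hMk hM hd1, ?_⟩
    have hk2 : ((k / 2 : ℕ) : ℝ) ≤ k / 2 := Nat.cast_div_le
    have hsqrt : Real.sqrt (((k / 2 : ℕ) : ℝ) * ((m + 1 : ℕ) : ℝ)) ≤ 7 / 8 * s := by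
      apply Real.sqrt_le_iff.2
      refine ⟨by positivity, ?_⟩
      rw [mul_pow, hs2]
      push_cast
      have : ((k / 2 : ℕ) : ℝ) * ((m:ℝ) + 1) ≤ k / 2 * (m + 1) := by gcongr
      nlinarith
    have h3 := mul_le_mul_of_nonneg_left hsqrt hA0
    rw [Nat.cast_add]
    push_cast at hd2 h3 hMR ⊢
    have h4 : A / 8 * s = B * s + 32 * p * s := by rw [hA]; ring
    nlinarith

lemma pdeg_le_of {F : Type} [Field F] {n : ℕ} {f : (Fin n → Bool) → Bool} {ε : ℝ} {d : ℕ}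
    {Ω : Type} [Fintype Ω] [Nonempty Ω] (G : Ω → (Fin n → Bool) → Bool)
    (hG : ∀ ω, DegLE F (G ω) d)
    (he : ∀ a, (∑ ω, if G ω a = f a then (0:ℝ) else 1) ≤ ε * Fintype.card Ω) :
    pdeg F f ε ≤ d := by
  classical
  choose P hP1 hP2 using fun ω => hG ω (bF F)
  have hc : (0:ℝ) < Fintype.card Ω := by exact_mod_cast Fintype.card_pos
  apply Nat.sInf_le
  refine ⟨⟨Fintype.card Ω, fun _ => 1 / Fintype.card Ω, fun _ => by positivity, ?_,
    fun i => P ((Fintype.equivFin Ω).symm i)⟩, fun i => hP1 _, fun a => ?_⟩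
  · simp
  · unfold errAt
    simp only [hP2]
    rw [Equiv.sum_comp (Fintype.equivFin Ω).symm
      (fun ω => if bF F (G ω a) = bF F (f a) then (0:ℝ) else 1 / Fintype.card Ω)]
    have hle : ∀ ω, (if bF F (G ω a) = bF F (f a) then (0:ℝ) else 1 / Fintype.card Ω)
        ≤ (if G ω a = f a then (0:ℝ) else 1) * (1 / Fintype.card Ω) := by
      intro ω
      by_cases h : G ω a = f a
      · simp [h]
      · rw [if_neg h, one_mul]
        split_ifs
        · positivity
        · exact le_rfl
    refine (Finset.sum_le_sum fun ω _ => hle ω).trans ?_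
    rw [← Finset.sum_mul, mul_one_div, div_le_iff₀ hc]
    exact he a

lemma period_spec (n : ℕ) (spec : ℕ → Bool) :
    ∀ i, i ≤ n → spec i = spec (i % period n spec) := by
  have hmem : period n spec ∈ {b | 1 ≤ b ∧ ∀ i, i + b ≤ n → spec i = spec (i + b)} :=
    Nat.sInf_mem ⟨n + 1, by omega, fun i hi => by omega⟩
  obtain ⟨h1, h2⟩ := hmem
  generalize period n spec = P at *
  intro i
  induction i using Nat.strong_induction_on with
  | _ i ih =>
  intro hi
  rcases lt_or_ge i P with h | h
  · rw [Nat.mod_eq_of_lt h]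
  · have h3 := h2 (i - P) (by omega)
    rw [Nat.sub_add_cancel h] at h3
    rw [← h3, ih (i - P) (by omega) (by omega), ← Nat.mod_eq_sub_mod h]

lemma Bparam_spec (n : ℕ) (spec : ℕ → Bool) :
    ∀ i j, Bparam n spec ≤ i → i + Bparam n spec ≤ n → Bparam n spec ≤ j →
      j + Bparam n spec ≤ n → spec i = spec j := by
  have hmem : Bparam n spec ∈ {k | ∀ i j, k ≤ i → i + k ≤ n → k ≤ j → j + k ≤ n → spec i = spec j} :=
    Nat.sInf_mem ⟨n + 1, fun i j h1 h2 => by omega⟩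
  exact hmem

lemma wt_eq {n : ℕ} (a : Fin n → Bool) : wt a = cnt true Finset.univ a := rfl

lemma cnt_univ_add {n : ℕ} (a : Fin n → Bool) :
    cnt true Finset.univ a + cnt false Finset.univ a = n := by
  rw [cnt_add]; simp

lemma pdeg_le_full {F : Type} [Field F] {n m d : ℕ} {f : (Fin n → Bool) → Bool} {ε : ℝ}
    {specF : ℕ → Bool} (hf : ∀ a, f a = specF (wt a)) (hε : (1 / 2) ^ m * 2 ≤ ε)
    (h : PP F n (n + 1) m d) : pdeg F f ε ≤ d := by
  classical
  obtain ⟨Ω, i1, i2, V, h1, h2⟩ := h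
  refine pdeg_le_of (fun ω a => specF (V ω true Finset.univ a))
    (fun ω => (h1 ω true Finset.univ).comp specF) ?_
  intro a
  have hc : (0:ℝ) ≤ Fintype.card Ω := by positivity
  have hm : (0:ℝ) ≤ (1 / 2) ^ m := by positivity
  refine le_trans ?_ ((h2 true Finset.univ a).trans
    (mul_le_mul_of_nonneg_right (show (1 / 2 : ℝ) ^ m ≤ ε by linarith) hc))
  refine Finset.sum_le_sum fun ω _ => ?_
  by_cases ha : Approx (n + 1) (V ω true Finset.univ a) (cnt true Finset.univ a)
  · have := cnt_univ_add a
    have he : V ω true Finset.univ a = cnt true Finset.univ a := by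
      unfold Approx at ha
      omega
    rw [if_pos ha, he, if_pos (by rw [hf, wt_eq])]
  · rw [if_neg ha]
    split_ifs <;> norm_num

lemma pdeg_le_decomp {F : Type} [Field F] {p : ℕ} [CharP F p] (hp : p.Prime) {n m d t : ℕ}
    {f : (Fin n → Bool) → Bool} {ε : ℝ}
    {specF specG : ℕ → Bool} (hf : ∀ a, f a = specF (wt a)) (hε : (1 / 2) ^ m * 2 ≤ ε)
    (ht : period n specG = p ^ t)
    (h : PP F n (Bparam n (fun i => Bool.xor (specF i) (specG i))) m d) :
    pdeg F f ε ≤ p ^ t + (d + d) := by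
  classical
  have hB := Bparam_spec n (fun i => Bool.xor (specF i) (specG i))
  have hP := period_spec n specG
  rw [ht] at hP
  generalize Bparam n (fun i => Bool.xor (specF i) (specG i)) = B at *
  set hh : ℕ → Bool := fun i => Bool.xor (specF i) (specG i) with hhdef
  obtain ⟨Ω, i1, i2, V, h1, h2⟩ := h
  set rec : ℕ → ℕ → ℕ → Bool := fun r u v =>
    Bool.xor (if u < B then hh u else if v < B then hh (n - v) else hh B) (specG r) with hrec
  refine pdeg_le_of (fun ω a => rec (cnt true Finset.univ a % p ^ t)
    (V ω true Finset.univ a) (V ω false Finset.univ a)) (fun ω => ?_) ?_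
  · exact ((degLE_cnt F p hp t true Finset.univ).prod
      ((h1 ω true Finset.univ).prod (h1 ω false Finset.univ))).comp
      (fun x => rec x.1 x.2.1 x.2.2)
  intro a
  have hc : (0:ℝ) ≤ Fintype.card Ω := by positivity
  have e1 := h2 true Finset.univ a
  have e2 := h2 false Finset.univ a
  have e3 := mul_le_mul_of_nonneg_right hε hc
  refine le_trans ?_ (show _ ≤ ε * (Fintype.card Ω : ℝ) from
    (show (∑ ω, if Approx B (V ω true Finset.univ a) (cnt true Finset.univ a) then (0:ℝ) else 1)
      + (∑ ω, if Approx B (V ω false Finset.univ a) (cnt false Finset.univ a) then (0:ℝ) else 1)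
      ≤ _ by linarith))
  rw [← Finset.sum_add_distrib]
  refine Finset.sum_le_sum fun ω _ => ?_
  by_cases a1 : Approx B (V ω true Finset.univ a) (cnt true Finset.univ a)
  · by_cases a2 : Approx B (V ω false Finset.univ a) (cnt false Finset.univ a)
    · rw [if_pos a1, if_pos a2, if_pos]
      · norm_num
      · rw [hf, wt_eq]
        have hadd := cnt_univ_add a
        generalize cnt true Finset.univ a = w at *
        generalize cnt false Finset.univ a = w' at *
        generalize V ω true Finset.univ a = u at *
        generalize V ω false Finset.univ a = v at *
        have hx : (if u < B then hh u else if v < B then hh (n - v) else hh B) = hh w := by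
          unfold Approx at a1 a2
          split_ifs with q1 q2
          · congr 1; omega
          · congr 1; omega
          · exact hB _ _ le_rfl (by omega) (by omega) (by omega)
        simp only [hrec]
        rw [hx, ← hP w (by omega)]
        simp [hhdef]
    · rw [if_neg a2]
      split_ifs <;> norm_num
  · rw [if_neg a1]
    split_ifs <;> norm_num


/-- over characteristic `p > 0`, if `f` has standard decomposition
`(g,h)` with `per(g)` a power of `p`, then
`pdeg_ε(f) ≤ C_p · min{√(n log(1/ε)), per(g) + √(B(h) log(1/ε)) + log(1/ε)}`. -/
theorem stmt3 :
    ∀ p : ℕ, p.Prime →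
      ∃ C : ℝ, 0 < C ∧
        ∀ (F : Type) [Field F] [CharP F p],
          ∀ n : ℕ, 1 ≤ n →
            ∀ (f : (Fin n → Bool) → Bool) (specF specG : ℕ → Bool),
              (∀ a, f a = specF (wt a)) →
              (∀ i, (n + 2) / 3 ≤ i → i ≤ 2 * n / 3 → specG i = specF i) →
              (∀ specG' : ℕ → Bool,
                (∀ i, (n + 2) / 3 ≤ i → i ≤ 2 * n / 3 → specG' i = specF i) →
                period n specG ≤ period n specG') →
              (∃ t : ℕ, period n specG = p ^ t) →
              ∀ ε : ℝ, 0 < ε → ε < 1/3 →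
                (pdeg F f ε : ℝ)
                  ≤ C * min (Real.sqrt (n * Real.logb 2 (1/ε)))
                      ((period n specG : ℝ) +
                        Real.sqrt
                          ((Bparam n (fun i => Bool.xor (specF i) (specG i)) : ℝ) *
                            Real.logb 2 (1/ε)) +
                        Real.logb 2 (1/ε)) := by
  intro p hp
  have hp1 : (1:ℝ) ≤ p := by exact_mod_cast hp.one_lt.le
  obtain ⟨B, hB⟩ : ∃ B : ℝ, B = 2 ^ 38 * (p:ℝ) ^ 3 + 16 * p := ⟨_, rfl⟩
  obtain ⟨A, hA⟩ : ∃ A : ℝ, A = 8 * (B + 32 * p) := ⟨_, rfl⟩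
  have hB0 : 0 ≤ B := by rw [hB]; positivity
  have hA0 : 0 ≤ A := by rw [hA]; positivity
  refine ⟨6 * A + 6 * B + 1, by positivity, ?_⟩
  intro F _ _ n hn f specF specG hf _ _ hper ε hε0 hε1
  obtain ⟨t, ht⟩ := hper
  set l := Real.logb 2 (1 / ε) with hl
  have hε3 : 2 ≤ 1 / ε := by
    rw [le_div_iff₀ hε0]; linarith
  have hl1 : 1 ≤ l := by
    rw [hl, Real.le_logb_iff_rpow_le (by norm_num) (by positivity)]
    simpa using hε3
  obtain ⟨m, hm⟩ : ∃ m : ℕ, m = ⌈l⌉₊ + 1 := ⟨_, rfl⟩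
  have hceil : l ≤ ⌈l⌉₊ := Nat.le_ceil l
  have hceil2 : (⌈l⌉₊ : ℝ) < l + 1 := Nat.ceil_lt_add_one (by linarith)
  have hm2 : 2 ≤ m := by
    have : 0 < ⌈l⌉₊ := Nat.ceil_pos.2 (by linarith)
    omega
  have hm3 : (m : ℝ) ≤ 3 * l := by
    rw [hm]; push_cast; linarith
  have hεm : (1 / 2 : ℝ) ^ m * 2 ≤ ε := by
    have h1 : 1 / ε ≤ 2 ^ ⌈l⌉₊ := by
      have : (2:ℝ) ^ l = 1 / ε := Real.rpow_logb (by norm_num) (by norm_num) (by positivity)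
      rw [← this, ← Real.rpow_natCast]
      exact Real.rpow_le_rpow_of_exponent_le (by norm_num) hceil
    rw [hm, pow_succ]
    have h2 : (1 / 2 : ℝ) ^ ⌈l⌉₊ ≤ ε := by
      rw [one_div, inv_pow]
      rw [one_div] at h1
      exact inv_le_of_inv_le₀ hε0 h1
    linarith
  have hnR : (1:ℝ) ≤ n := by exact_mod_cast hn
  rw [mul_min_of_nonneg _ _ (by positivity : (0:ℝ) ≤ 6 * A + 6 * B + 1)]
  apply le_min
  · set s := Real.sqrt (n * l) with hs
    have hs0 : 0 ≤ s := Real.sqrt_nonneg _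
    have hs2 : s ^ 2 = n * l := Real.sq_sqrt (by positivity)
    rcases le_or_gt l n with hln | hln
    · obtain ⟨d, hd1, hd2⟩ := PP.main hp F n A B hB hA (n + 1) m hm2
      have h := pdeg_le_full hf hεm hd1
      have hR : (pdeg F f ε : ℝ) ≤ d := by exact_mod_cast h
      have hls : l ≤ s := by
        apply Real.le_sqrt_of_sq_le
        nlinarith
      have hsq : Real.sqrt (((n + 1 : ℕ) : ℝ) * m) ≤ 3 * s := by
        apply Real.sqrt_le_iff.2
        refine ⟨by positivity, ?_⟩
        rw [mul_pow, hs2]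
        push_cast
        have : ((n:ℝ) + 1) * m ≤ (2 * n) * (3 * l) := by gcongr; linarith
        nlinarith
      have h3 := mul_le_mul_of_nonneg_left hsq hA0
      have h4 : B * m ≤ B * (3 * s) := by gcongr; linarith
      nlinarith
    · have h : pdeg F f ε ≤ n := by
        refine pdeg_le_of (Ω := Unit) (fun _ a => f a) (fun _ => (degLE_id F).comp f) ?_
        intro a
        simp
        exact hε0.le
      have hR : (pdeg F f ε : ℝ) ≤ n := by exact_mod_cast h
      have hns : (n : ℝ) ≤ s := by
        apply Real.le_sqrt_of_sq_le
        nlinarith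
      nlinarith [mul_nonneg hA0 hs0, mul_nonneg hB0 hs0]
  · obtain ⟨d, hd1, hd2⟩ := PP.main hp F n A B hB hA
      (Bparam n (fun i => Bool.xor (specF i) (specG i))) m hm2
    have h := pdeg_le_decomp hp hf hεm ht hd1
    have hR : (pdeg F f ε : ℝ) ≤ (p ^ t : ℕ) + (d + d) := by exact_mod_cast h
    rw [← ht] at hR
    generalize Bparam n (fun i => Bool.xor (specF i) (specG i)) = b at *
    generalize period n specG = P at *
    set s := Real.sqrt (b * l) with hs
    have hs0 : 0 ≤ s := Real.sqrt_nonneg _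
    have hs2 : s ^ 2 = b * l := Real.sq_sqrt (by positivity)
    have hsq : Real.sqrt ((b : ℝ) * m) ≤ 3 * s := by
      apply Real.sqrt_le_iff.2
      refine ⟨by positivity, ?_⟩
      rw [mul_pow, hs2]
      have : (b:ℝ) * m ≤ b * (3 * l) := by gcongr
      have : (0:ℝ) ≤ b * l := by positivity
      nlinarith
    have h3 := mul_le_mul_of_nonneg_left hsq hA0
    have h4 : B * m ≤ B * (3 * l) := by gcongr
    have hP0 : (0:ℝ) ≤ P := by positivity
    have q1 : 0 ≤ A * P := by positivity
    have q2 : 0 ≤ B * P := by positivity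
    have q3 : 0 ≤ A * l := by positivity
    have q4 : 0 ≤ B * s := by positivity
    nlinarith
end
end
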